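/- Suppose the cutoff function satisfies the cancellation condition ∫ φ(s) ds = 0. Then the operators H_j satisfy the almost-orthogonality estimates ‖H_j H_k^*‖_{L²→L²} + ‖H_j^* H_k‖_{L²→L²} ≲ 2^{-|j-k|/2}, uniformly in j, k. -/

import Mathlib

open MeasureTheory Set Filter
open scoped ENNReal NNReal

noncomputable section

/-- The dyadically rescaled cutoff `φ_j(s) = 2^j φ(2^j s)`. -/
def phiJ (φ : ℝ → ℝ) (j : ℤ) (s : ℝ) : ℝ := (2:ℝ) ^ j * φ ((2:ℝ) ^ j * s)

/-- The dyadic pieces `β_k(s) = β₀(2^{-k} s) - β₀(2^{-k+1} s)`. -/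
def betaZ (β0 : ℝ → ℝ) (k : ℤ) (s : ℝ) : ℝ :=
  β0 ((2:ℝ) ^ (-k) * s) - β0 ((2:ℝ) ^ (-k + 1) * s)

/-- The kernel `R_j^k(x,y) = χ(x,y) φ_j(x₁-y₁) ∫ e^{iτ(y₂-γ(x,x₁-y₁))} β_k(τ) dτ`. -/
def kernelR (χ : ℝ × ℝ → ℝ × ℝ → ℝ) (φ : ℝ → ℝ) (γ : ℝ × ℝ → ℝ → ℝ) (β0 : ℝ → ℝ)
    (j k : ℤ) (x y : ℝ × ℝ) : ℂ :=
  ((χ x y * phiJ φ j (x.1 - y.1) : ℝ) : ℂ) *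
    ∫ τ : ℝ, ((betaZ β0 k τ : ℝ) : ℂ) *
      Complex.exp (Complex.I * (τ : ℂ) * ((y.2 - γ x (x.1 - y.1) : ℝ) : ℂ))

/-- The kernel `H_j(x,y) = χ(x,y) φ_j(x₁-y₁) ∫ e^{iτ(y₂-γ(x,x₁-y₁))} β₀(2^{-a_j}τ) dτ`. -/
def kernelH (χ : ℝ × ℝ → ℝ × ℝ → ℝ) (φ : ℝ → ℝ) (γ : ℝ × ℝ → ℝ → ℝ) (β0 : ℝ → ℝ)
    (j aj : ℤ) (x y : ℝ × ℝ) : ℂ :=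
  ((χ x y * phiJ φ j (x.1 - y.1) : ℝ) : ℂ) *
    ∫ τ : ℝ, ((β0 ((2:ℝ) ^ (-aj) * τ) : ℝ) : ℂ) *
      Complex.exp (Complex.I * (τ : ℂ) * ((y.2 - γ x (x.1 - y.1) : ℝ) : ℂ))

/-- Integral operator with kernel `K`. -/
def opK (K : ℝ × ℝ → ℝ × ℝ → ℂ) (f : ℝ × ℝ → ℂ) (x : ℝ × ℝ) : ℂ := ∫ y, K x y * f y

/-- The adjoint kernel. -/
def adjK (K : ℝ × ℝ → ℝ × ℝ → ℂ) (x y : ℝ × ℝ) : ℂ := starRingEnd ℂ (K y x)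

/-- Fourier multiplier in the second variable (kernel convention `e^{iξ(x₂-y₂)}`). -/
def mult2 (m : ℝ → ℝ) (f : ℝ × ℝ → ℂ) (x : ℝ × ℝ) : ℂ :=
  ((2 * Real.pi)⁻¹ : ℝ) • ∫ ξ : ℝ, ∫ y : ℝ,
    ((m ξ : ℝ) : ℂ) * Complex.exp (Complex.I * (ξ : ℂ) * ((x.2 - y : ℝ) : ℂ)) * f (x.1, y)

/-- Fourier multiplier in the first variable. -/
def mult1 (m : ℝ → ℝ) (f : ℝ × ℝ → ℂ) (x : ℝ × ℝ) : ℂ :=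
  ((2 * Real.pi)⁻¹ : ℝ) • ∫ ξ : ℝ, ∫ y : ℝ,
    ((m ξ : ℝ) : ℂ) * Complex.exp (Complex.I * (ξ : ℂ) * ((x.1 - y : ℝ) : ℂ)) * f (y, x.2)

/-- The symbol of the Littlewood-Paley operator `L^k`:
`β₀(2^{-k-10} ξ₂) - β₀(2^{-k+10} ξ₂)`. -/
def symbL (β0 : ℝ → ℝ) (k : ℤ) (ξ : ℝ) : ℝ :=
  β0 ((2:ℝ) ^ (-k - 10) * ξ) - β0 ((2:ℝ) ^ (-k + 10) * ξ)

/-- The Littlewood-Paley operator `L^k` (multiplier in `ξ₂`). -/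
def opL (β0 : ℝ → ℝ) (k : ℤ) : (ℝ × ℝ → ℂ) → ℝ × ℝ → ℂ := mult2 (symbL β0 k)

/-- `P_l`, multiplier `β₀(2^{-l} ξ₁)`. -/
def opP (β0 : ℝ → ℝ) (l : ℤ) : (ℝ × ℝ → ℂ) → ℝ × ℝ → ℂ :=
  mult1 (fun ξ => β0 ((2:ℝ) ^ (-l) * ξ))

/-- `Q_l`, multiplier `β_l(ξ₁)`. -/
def opQ (β0 : ℝ → ℝ) (l : ℤ) : (ℝ × ℝ → ℂ) → ℝ × ℝ → ℂ := mult1 (betaZ β0 l)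

/-- The strong maximal function (over axis-parallel rectangles). -/
def Mstr (f : ℝ × ℝ → ℂ) (x : ℝ × ℝ) : ℝ≥0∞ :=
  ⨆ (a₁ : ℝ) (b₁ : ℝ) (a₂ : ℝ) (b₂ : ℝ) (_ : x.1 ∈ Ioo a₁ b₁) (_ : x.2 ∈ Ioo a₂ b₂),
    (ENNReal.ofReal ((b₁ - a₁) * (b₂ - a₂)))⁻¹ *
      ∫⁻ y in Ioo a₁ b₁ ×ˢ Ioo a₂ b₂, ‖f y‖₊

/-- The strong maximal function of a real-valued function. -/
def MstrR (f : ℝ × ℝ → ℝ) (x : ℝ × ℝ) : ℝ≥0∞ :=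
  ⨆ (a₁ : ℝ) (b₁ : ℝ) (a₂ : ℝ) (b₂ : ℝ) (_ : x.1 ∈ Ioo a₁ b₁) (_ : x.2 ∈ Ioo a₂ b₂),
    (ENNReal.ofReal ((b₁ - a₁) * (b₂ - a₂)))⁻¹ *
      ∫⁻ y in Ioo a₁ b₁ ×ˢ Ioo a₂ b₂, ‖f y‖₊

/-- `L^p → L^p` operator (quasi-)norm, tested on continuous compactly supported functions. -/
def opNorm (p : ℝ≥0∞) (T : (ℝ × ℝ → ℂ) → ℝ × ℝ → ℂ) : ℝ≥0∞ :=
  sInf {C : ℝ≥0∞ | ∀ f : ℝ × ℝ → ℂ, Continuous f → HasCompactSupport f →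
    eLpNorm (T f) p volume ≤ C * eLpNorm f p volume}

/-- The averaging operator `M_j` along the curves, at scale `2^{-j}`. -/
def opM (χt : ℝ × ℝ → ℝ × ℝ → ℝ) (φt : ℝ → ℝ) (γ : ℝ × ℝ → ℝ → ℝ) (j : ℤ)
    (f : ℝ × ℝ → ℂ) (x : ℝ × ℝ) : ℂ :=
  ∫ y₁ : ℝ, (phiJ φt j (x.1 - y₁) * χt x (y₁, x.2 + γ x (x.1 - y₁))) •
    f (y₁, x.2 + γ x (x.1 - y₁))

/-- The averaging operator `M_j` acting on real-valued functions. -/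
def opMR (χt : ℝ × ℝ → ℝ × ℝ → ℝ) (φt : ℝ → ℝ) (γ : ℝ × ℝ → ℝ → ℝ) (j : ℤ)
    (f : ℝ × ℝ → ℝ) (x : ℝ × ℝ) : ℝ :=
  ∫ y₁ : ℝ, phiJ φt j (x.1 - y₁) * χt x (y₁, x.2 + γ x (x.1 - y₁)) *
    f (y₁, x.2 + γ x (x.1 - y₁))

/-- Standing hypotheses on `β₀`. -/
structure IsBump (β0 : ℝ → ℝ) : Prop where
  smooth : ContDiff ℝ (⊤ : ℕ∞) β0
  even : ∀ s, β0 (-s) = β0 s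
  one : ∀ s, |s| ≤ 1 / 2 → β0 s = 1
  zero : ∀ s, 3 / 4 ≤ |s| → β0 s = 0

/-- Standing hypotheses on `φ`. -/
structure IsPhi (φ : ℝ → ℝ) : Prop where
  smooth : ContDiff ℝ (⊤ : ℕ∞) φ
  supp : ∀ s, φ s ≠ 0 → 1 / 2 < |s| ∧ |s| < 2

/-- Standing hypotheses on `χ`. -/
structure IsChi (χ : ℝ × ℝ → ℝ × ℝ → ℝ) : Prop where
  smooth : ContDiff ℝ (⊤ : ℕ∞) (fun p : (ℝ × ℝ) × (ℝ × ℝ) => χ p.1 p.2)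
  cpt : HasCompactSupport (fun p : (ℝ × ℝ) × (ℝ × ℝ) => χ p.1 p.2)

/-- `g` is a doubling function (on `[0,∞)`) with doubling constant `A`. -/
structure IsDoubling (g : ℝ → ℝ) (A : ℝ) : Prop where
  A_ge_one : 1 ≤ A
  cont : ContinuousOn g (Ici 0)
  zero : g 0 = 0
  pos : ∀ t, 0 < t → 0 < g t
  dbl : ∀ t₁ t₂, 0 ≤ t₁ → A * t₁ ≤ t₂ → 2 * g t₁ ≤ g t₂

/-- The defining property of the integers `a_j`: `2^{-a_j-1} < 2^{-j} g(2^{-5-j} B) ≤ 2^{-a_j}`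
with `B = 2^20 A`. -/
def ajSpec (g : ℝ → ℝ) (A : ℝ) (a : ℤ → ℤ) : Prop :=
  ∀ j : ℤ, (2:ℝ) ^ (-a j - 1) < (2:ℝ) ^ (-j) * g ((2:ℝ) ^ (-5 - j) * (2 ^ 20 * A)) ∧
    (2:ℝ) ^ (-j) * g ((2:ℝ) ^ (-5 - j) * (2 ^ 20 * A)) ≤ (2:ℝ) ^ (-a j)

/-- The defining property of the integers `b_j`: `2^{-b_j-1} < 2^{-j} g(2^{5-j} B⁻¹) ≤ 2^{-b_j}`
with `B = 2^20 A`. -/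
def bjSpec (g : ℝ → ℝ) (A : ℝ) (b : ℤ → ℤ) : Prop :=
  ∀ j : ℤ, (2:ℝ) ^ (-b j - 1) < (2:ℝ) ^ (-j) * g ((2:ℝ) ^ (5 - j) * (2 ^ 20 * A)⁻¹) ∧
    (2:ℝ) ^ (-j) * g ((2:ℝ) ^ (5 - j) * (2 ^ 20 * A)⁻¹) ≤ (2:ℝ) ^ (-b j)

/-- The normalized curve hypotheses (1.19)-(1.24) of Theorem B:  `γ(x,0) = x₂`,
`γ̇(x,0) = 0`, quasi-monotonicity of `γ̇`, doubling bounds for `|γ̇|`, and bounds for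
`γ_{x₂}` and its gradient. -/
structure CurveHyp (c₀ A C₀ κ c₁ M : ℝ) (g : ℝ → ℝ)
    (γ γd γdd γ2 : ℝ × ℝ → ℝ → ℝ) : Prop where
  c₀_pos : 0 < c₀
  init : ∀ x : ℝ × ℝ, γ x 0 = x.2
  initd : ∀ x : ℝ × ℝ, γd x 0 = 0
  deriv1 : ∀ x t, |t| ≤ c₀ → HasDerivAt (γ x) (γd x t) t
  deriv2 : ∀ x t, |t| ≤ c₀ → HasDerivAt (γd x) (γdd x t) t
  derivx2 : ∀ (x : ℝ × ℝ) t, |t| ≤ c₀ → HasDerivAt (fun v => γ (x.1, v) t) (γ2 x t) x.2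
  smooth : ContDiff ℝ (⊤ : ℕ∞) (fun p : (ℝ × ℝ) × ℝ => γ p.1 p.2)
  qm : ∃ a E : ℝ × ℝ → ℝ → ℝ,
    (∀ x t, |t| ≤ c₀ → γdd x t = a x t + E x t) ∧
    (∀ x t, |t| ≤ c₀ → |E x t| ≤ κ * |γd x t|) ∧
    (∀ x, (∀ t ∈ Ioc (0:ℝ) c₀, 0 ≤ a x t) ∨ (∀ t ∈ Ioc (0:ℝ) c₀, a x t ≤ 0)) ∧
    (∀ x, (∀ t ∈ Ico (-c₀) (0:ℝ), 0 ≤ a x t) ∨ (∀ t ∈ Ico (-c₀) (0:ℝ), a x t ≤ 0))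
  dbl : ∀ x t, |t| ≤ c₀ →
    C₀⁻¹ * g (A⁻¹ * |t|) ≤ |γd x t| ∧ |γd x t| ≤ C₀ * g (A * |t|)
  g2_lower : ∀ x t, |t| ≤ c₀ → c₁ ≤ |γ2 x t|
  g2_upper : ∀ x t, |t| ≤ c₀ → |γ2 x t| ≤ M
  g2_grad : ∀ x t, |t| ≤ c₀ →
    ‖fderiv ℝ (fun p : (ℝ × ℝ) × ℝ => γ2 p.1 p.2) (x, t)‖ ≤ M


lemma schur_test (K : ℝ × ℝ → ℝ × ℝ → ℂ) (hK : Measurable (Function.uncurry K)) (c : ℝ≥0∞)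
    (h1 : ∀ x, ∫⁻ y, ‖K x y‖ₑ ≤ c) (h2 : ∀ y, ∫⁻ x, ‖K x y‖ₑ ≤ c)
    (f : ℝ × ℝ → ℂ) (hf : Measurable f) :
    eLpNorm (opK K f) 2 volume ≤ c * eLpNorm f 2 volume := by
  have key : ∀ x, ‖opK K f x‖ₑ ^ (2:ℝ) ≤ c * ∫⁻ y, ‖K x y‖ₑ * ‖f y‖ₑ ^ (2:ℝ) := by
    intro x
    have hKx : Measurable (fun y => ‖K x y‖ₑ) :=
      (hK.comp (measurable_const.prodMk measurable_id)).enorm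
    have e1 : ‖opK K f x‖ₑ ≤ ∫⁻ y, ‖K x y‖ₑ * ‖f y‖ₑ := by
      unfold opK
      refine (enorm_integral_le_lintegral_enorm _).trans (le_of_eq ?_)
      simp only [enorm_mul]
    have e2 : ∫⁻ y, ‖K x y‖ₑ * ‖f y‖ₑ
        = ∫⁻ y, ((fun y => ‖K x y‖ₑ ^ (1/2:ℝ)) * (fun y => ‖K x y‖ₑ ^ (1/2:ℝ) * ‖f y‖ₑ)) y := by
      refine lintegral_congr fun y => ?_
      simp only [Pi.mul_apply]
      rw [← mul_assoc, ← ENNReal.rpow_add_of_nonneg _ _ (by norm_num) (by norm_num)]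
      norm_num
    have e3 := ENNReal.lintegral_mul_le_Lp_mul_Lq volume (p := 2) (q := 2)
      (by constructor <;> norm_num)
      (f := fun y => ‖K x y‖ₑ ^ (1/2:ℝ)) (g := fun y => ‖K x y‖ₑ ^ (1/2:ℝ) * ‖f y‖ₑ)
      (hKx.pow_const _).aemeasurable ((hKx.pow_const _).mul hf.enorm).aemeasurable
    have e4 : ∀ y, (‖K x y‖ₑ ^ (1/2:ℝ)) ^ (2:ℝ) = ‖K x y‖ₑ := by
      intro y
      rw [← ENNReal.rpow_mul]; norm_num
    have e5 : ∀ y, (‖K x y‖ₑ ^ (1/2:ℝ) * ‖f y‖ₑ) ^ (2:ℝ) = ‖K x y‖ₑ * ‖f y‖ₑ ^ (2:ℝ) := by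
      intro y
      rw [ENNReal.mul_rpow_of_nonneg _ _ (by norm_num), e4]
    simp only [e4, e5] at e3
    calc ‖opK K f x‖ₑ ^ (2:ℝ)
        ≤ ((∫⁻ y, ‖K x y‖ₑ) ^ (1/2:ℝ) * (∫⁻ y, ‖K x y‖ₑ * ‖f y‖ₑ ^ (2:ℝ)) ^ (1/2:ℝ)) ^ (2:ℝ) := by
          gcongr
          exact (e1.trans e2.le).trans e3
      _ = (∫⁻ y, ‖K x y‖ₑ) * ∫⁻ y, ‖K x y‖ₑ * ‖f y‖ₑ ^ (2:ℝ) := by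
          rw [ENNReal.mul_rpow_of_nonneg _ _ (by norm_num), ← ENNReal.rpow_mul, ← ENNReal.rpow_mul]
          norm_num
      _ ≤ _ := by gcongr; exact h1 x
  have hKm : Measurable (fun p : (ℝ × ℝ) × (ℝ × ℝ) => ‖K p.1 p.2‖ₑ * ‖f p.2‖ₑ ^ (2:ℝ)) :=
    hK.enorm.mul ((hf.comp measurable_snd).enorm.pow_const _)
  have tot : ∫⁻ x, ‖opK K f x‖ₑ ^ (2:ℝ) ≤ c ^ (2:ℝ) * ∫⁻ y, ‖f y‖ₑ ^ (2:ℝ) := by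
    calc ∫⁻ x, ‖opK K f x‖ₑ ^ (2:ℝ) ≤ ∫⁻ x, c * ∫⁻ y, ‖K x y‖ₑ * ‖f y‖ₑ ^ (2:ℝ) :=
          lintegral_mono key
      _ = c * ∫⁻ x, ∫⁻ y, ‖K x y‖ₑ * ‖f y‖ₑ ^ (2:ℝ) := by
          rw [lintegral_const_mul]
          exact hKm.lintegral_prod_right'
      _ = c * ∫⁻ y, ∫⁻ x, ‖K x y‖ₑ * ‖f y‖ₑ ^ (2:ℝ) := by
          rw [lintegral_lintegral_swap hKm.aemeasurable]
      _ = c * ∫⁻ y, (∫⁻ x, ‖K x y‖ₑ) * ‖f y‖ₑ ^ (2:ℝ) := by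
          congr 1
          refine lintegral_congr fun y => ?_
          rw [lintegral_mul_const]
          exact (hK.comp (measurable_id.prodMk measurable_const)).enorm
      _ ≤ c * ∫⁻ y, c * ‖f y‖ₑ ^ (2:ℝ) := by
          gcongr with y
          exact h2 y
      _ = c ^ (2:ℝ) * ∫⁻ y, ‖f y‖ₑ ^ (2:ℝ) := by
          rw [lintegral_const_mul _ (hf.enorm.pow_const _), ← mul_assoc]
          congr 1
          rw [ENNReal.rpow_two, sq]
  rw [eLpNorm_eq_lintegral_rpow_enorm_toReal (by norm_num) (by norm_num),
    eLpNorm_eq_lintegral_rpow_enorm_toReal (by norm_num) (by norm_num)]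
  simp only [ENNReal.toReal_ofNat]
  calc (∫⁻ x, ‖opK K f x‖ₑ ^ (2:ℝ)) ^ (1/2:ℝ)
      ≤ (c ^ (2:ℝ) * ∫⁻ y, ‖f y‖ₑ ^ (2:ℝ)) ^ (1/2:ℝ) := by gcongr
    _ = _ := by
      rw [ENNReal.mul_rpow_of_nonneg _ _ (by norm_num), ← ENNReal.rpow_mul]
      norm_num

lemma opNorm_le_of (T : (ℝ × ℝ → ℂ) → ℝ × ℝ → ℂ) (c : ℝ≥0∞)
    (h : ∀ f : ℝ × ℝ → ℂ, Continuous f → HasCompactSupport f →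
      eLpNorm (T f) 2 volume ≤ c * eLpNorm f 2 volume) : opNorm 2 T ≤ c := sInf_le h

/-- kernel of `K L^*` -/
def prodK (K L : ℝ × ℝ → ℝ × ℝ → ℂ) (x z : ℝ × ℝ) : ℂ := ∫ y, K x y * starRingEnd ℂ (L z y)

lemma prodK_swap (K L : ℝ × ℝ → ℝ × ℝ → ℂ) (x z : ℝ × ℝ) : ‖prodK K L x z‖ = ‖prodK L K z x‖ := by
  unfold prodK
  rw [← RCLike.norm_conj, ← integral_conj]
  congr 2
  funext y
  simp [mul_comm]

lemma cpt_section {K : ℝ × ℝ → ℝ × ℝ → ℂ} (hs : HasCompactSupport (Function.uncurry K)) :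
    ∃ S : Set (ℝ × ℝ), IsCompact S ∧ ∀ x y, y ∉ S → K x y = 0 := by
  refine ⟨Prod.snd '' tsupport (Function.uncurry K), hs.isCompact.image continuous_snd, ?_⟩
  intro x y hy
  by_contra h
  exact hy ⟨(x, y), subset_tsupport _ h, rfl⟩

lemma cpt_bdd {K : ℝ × ℝ → ℝ × ℝ → ℂ} (hc : Continuous (Function.uncurry K))
    (hs : HasCompactSupport (Function.uncurry K)) : ∃ C : ℝ, ∀ x y, ‖K x y‖ ≤ C := by
  obtain ⟨C, hC⟩ := hs.exists_bound_of_continuous hc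
  exact ⟨C, fun x y => hC (x, y)⟩

lemma cpt_integrable {K : ℝ × ℝ → ℝ × ℝ → ℂ} (hc : Continuous (Function.uncurry K))
    (hs : HasCompactSupport (Function.uncurry K)) (x : ℝ × ℝ) : Integrable (K x) := by
  have h1 : Continuous (K x) := hc.comp (by fun_prop : Continuous fun y => (x, y))
  obtain ⟨S, hS, h0⟩ := cpt_section hs
  exact h1.integrable_of_hasCompactSupport (HasCompactSupport.intro hS fun y hy => h0 x y hy)

lemma opK_comp (K L : ℝ × ℝ → ℝ × ℝ → ℂ)
    (hKc : Continuous (Function.uncurry K)) (hKs : HasCompactSupport (Function.uncurry K))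
    (hLc : Continuous (Function.uncurry L))
    (f : ℝ × ℝ → ℂ) (hf : Continuous f) (hfs : HasCompactSupport f) :
    opK K (opK (adjK L) f) = opK (prodK K L) f := by
  funext x
  unfold opK prodK adjK
  obtain ⟨S, hS, h0⟩ := cpt_section hKs
  have hint : Integrable (Function.uncurry fun y z => K x y * (starRingEnd ℂ (L z y) * f z))
      (volume.prod volume) := by
    apply Continuous.integrable_of_hasCompactSupport
    · have c1 : Continuous (fun p : (ℝ × ℝ) × (ℝ × ℝ) => K x p.1) :=
        hKc.comp (by fun_prop : Continuous fun p : (ℝ × ℝ) × (ℝ × ℝ) => (x, p.1))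
      have c2 : Continuous (fun p : (ℝ × ℝ) × (ℝ × ℝ) => L p.2 p.1) :=
        hLc.comp (by fun_prop : Continuous fun p : (ℝ × ℝ) × (ℝ × ℝ) => (p.2, p.1))
      exact c1.mul ((Complex.continuous_conj.comp c2).mul (hf.comp continuous_snd))
    · refine HasCompactSupport.intro (hS.prod hfs.isCompact) ?_
      rintro ⟨y, z⟩ hyz
      simp only [Set.mem_prod, not_and_or] at hyz
      rcases hyz with h | h
      · simp [h0 x y h]
      · simp [image_eq_zero_of_notMem_tsupport h]
  calc ∫ y, K x y * ∫ z, starRingEnd ℂ (L z y) * f z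
      = ∫ y, ∫ z, K x y * (starRingEnd ℂ (L z y) * f z) := by
        simp only [integral_const_mul]
    _ = ∫ z, ∫ y, K x y * (starRingEnd ℂ (L z y) * f z) := integral_integral_swap hint
    _ = _ := by
        congr 1; funext z
        rw [← integral_mul_const]
        congr 1; funext y; ring

lemma prodK_meas (K L : ℝ × ℝ → ℝ × ℝ → ℂ)
    (hKc : Continuous (Function.uncurry K)) (hLc : Continuous (Function.uncurry L)) :
    Measurable (Function.uncurry (prodK K L)) := by
  have c : Continuous (fun p : ((ℝ × ℝ) × (ℝ × ℝ)) × (ℝ × ℝ) =>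
      K p.1.1 p.2 * starRingEnd ℂ (L p.1.2 p.2)) := by
    have c1 : Continuous (fun p : ((ℝ × ℝ) × (ℝ × ℝ)) × (ℝ × ℝ) => K p.1.1 p.2) :=
        hKc.comp (by fun_prop : Continuous fun p : ((ℝ × ℝ) × (ℝ × ℝ)) × (ℝ × ℝ) => (p.1.1, p.2))
    have c2 : Continuous (fun p : ((ℝ × ℝ) × (ℝ × ℝ)) × (ℝ × ℝ) => L p.1.2 p.2) :=
        hLc.comp (by fun_prop : Continuous fun p : ((ℝ × ℝ) × (ℝ × ℝ)) × (ℝ × ℝ) => (p.1.2, p.2))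
    exact c1.mul (Complex.continuous_conj.comp c2)
  exact (c.stronglyMeasurable.integral_prod_right (ν := volume)).measurable

/-- one-dimensional weight -/
def wt (n : ℕ) (r s : ℝ) : ℝ := r * ((1 + r * |s|) ^ n)⁻¹

/-- two-dimensional weight -/
def Wt (n : ℕ) (r q : ℝ) (u : ℝ × ℝ) : ℝ := wt n r u.1 * wt n q u.2

/-- the mass of the weight -/
def Iw : ℝ := ∫ s : ℝ, wt 2 1 s

lemma wt_nonneg {n : ℕ} {r s : ℝ} (hr : 0 < r) : 0 ≤ wt n r s := by unfold wt; positivity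
lemma Wt_nonneg {n : ℕ} {r q : ℝ} {u : ℝ × ℝ} (hr : 0 < r) (hq : 0 < q) : 0 ≤ Wt n r q u :=
  mul_nonneg (wt_nonneg hr) (wt_nonneg hq)
lemma wt_neg {n : ℕ} {r s : ℝ} : wt n r (-s) = wt n r s := by unfold wt; rw [abs_neg]
lemma Wt_neg {n : ℕ} {r q : ℝ} {u : ℝ × ℝ} : Wt n r q (-u) = Wt n r q u := by
  simp [Wt, wt_neg]
lemma Wt_symm {n : ℕ} {r q : ℝ} {u v : ℝ × ℝ} : Wt n r q (u - v) = Wt n r q (v - u) := by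
  rw [← Wt_neg, neg_sub]

lemma wt_continuous {n : ℕ} {r : ℝ} (hr : 0 < r) : Continuous (wt n r) := by
  unfold wt
  refine continuous_const.mul (Continuous.inv₀ (by fun_prop) ?_)
  intro s; positivity

lemma wt_mono {m n : ℕ} (hmn : m ≤ n) {r s : ℝ} (hr : 0 < r) : wt n r s ≤ wt m r s := by
  unfold wt
  gcongr
  have : 0 ≤ r * |s| := by positivity
  linarith

lemma Wt_mono {m n : ℕ} (hmn : m ≤ n) {r q : ℝ} {u : ℝ × ℝ} (hr : 0 < r) (hq : 0 < q) :
    Wt n r q u ≤ Wt m r q u :=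
  mul_le_mul (wt_mono hmn hr) (wt_mono hmn hq) (wt_nonneg hq) (wt_nonneg hr)

lemma wt_integrable_one : Integrable (wt 2 1) := by
  have h := integrable_one_add_norm (E := ℝ) (μ := volume) (r := 2) (by simp)
  refine h.congr (Eventually.of_forall fun s => ?_)
  have : (0:ℝ) ≤ 1 + |s| := by positivity
  simp [wt, Real.rpow_neg this]

lemma wt_scale {r : ℝ} : (wt 2 r = fun s => r * wt 2 1 (r * s)) ∨ r ≤ 0 := by
  by_cases hr : r ≤ 0
  · exact Or.inr hr
  · left; funext s
    have : 0 < r := not_le.mp hr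
    simp [wt, abs_mul, abs_of_pos this]

lemma wt_integrable {r : ℝ} (hr : 0 < r) : Integrable (wt 2 r) := by
  rcases wt_scale (r := r) with h | h
  · rw [h]
    exact (wt_integrable_one.comp_mul_left' hr.ne').const_mul r
  · linarith

lemma wt_integral {r : ℝ} (hr : 0 < r) : ∫ s, wt 2 r s = Iw := by
  rcases wt_scale (r := r) with h | h
  · rw [h, integral_const_mul, Measure.integral_comp_mul_left (wt 2 1) r, abs_of_pos (inv_pos.2 hr),
      smul_eq_mul, ← mul_assoc, mul_inv_cancel₀ hr.ne', one_mul]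
    rfl
  · linarith

lemma Iw_nonneg : 0 ≤ Iw := integral_nonneg fun _ => wt_nonneg one_pos

lemma Wt_integrable {r q : ℝ} (hr : 0 < r) (hq : 0 < q) : Integrable (Wt 2 r q) :=
  (wt_integrable hr).mul_prod (wt_integrable hq)

lemma Wt_integral {r q : ℝ} (hr : 0 < r) (hq : 0 < q) : ∫ u, Wt 2 r q u = Iw ^ 2 := by
  unfold Wt
  rw [Measure.volume_eq_prod, integral_prod_mul (wt 2 r) (wt 2 q), wt_integral hr, wt_integral hq, sq]

lemma Wt_integrable_sub {r q : ℝ} (hr : 0 < r) (hq : 0 < q) (x : ℝ × ℝ) :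
    Integrable fun y => Wt 2 r q (x - y) := (Wt_integrable hr hq).comp_sub_left x

lemma Wt_integral_sub {r q : ℝ} (hr : 0 < r) (hq : 0 < q) (x : ℝ × ℝ) :
    ∫ y, Wt 2 r q (x - y) = Iw ^ 2 := by
  rw [integral_sub_left_eq_self (Wt 2 r q) volume x, Wt_integral hr hq]

lemma wt_peetre {r s v : ℝ} (hr : 0 < r) (b : ℝ) (hb : |v| ≤ b) :
    wt 2 r (s + v) ≤ (1 + r * b) ^ 2 * wt 2 r s := by
  unfold wt
  have h1 : 0 < 1 + r * |s + v| := by positivity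
  have h2 : 0 < 1 + r * |s| := by positivity
  have hb0 : 0 ≤ b := (abs_nonneg v).trans hb
  have h4 : |s| ≤ |s + v| + |v| := by
    have := abs_add_le (s + v) (-v)
    rw [abs_neg] at this
    simpa using this
  have h3 : 1 + r * |s| ≤ (1 + r * |s + v|) * (1 + r * b) := by
    have : r * |s| ≤ r * (|s + v| + b) := by gcongr; linarith
    have : 0 ≤ r * |s + v| * (r * b) := by positivity
    nlinarith
  rw [mul_left_comm]
  gcongr
  rw [← div_eq_mul_inv, le_div_iff₀ (by positivity), inv_mul_le_iff₀ (by positivity), ← mul_pow]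
  gcongr

lemma Wt_peetre {r q : ℝ} (hr : 0 < r) (hq : 0 < q) (u v : ℝ × ℝ) (b c : ℝ)
    (hb : |v.1| ≤ b) (hc : |v.2| ≤ c) :
    Wt 2 r q (u + v) ≤ (1 + r * b) ^ 2 * (1 + q * c) ^ 2 * Wt 2 r q u := by
  unfold Wt
  have h1 := wt_peetre (s := u.1) hr b hb
  have h2 := wt_peetre (s := u.2) hq c hc
  calc _ ≤ ((1 + r * b) ^ 2 * wt 2 r u.1) * ((1 + q * c) ^ 2 * wt 2 q u.2) :=
        mul_le_mul h1 h2 (wt_nonneg hq) (mul_nonneg (sq_nonneg _) (wt_nonneg hr))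
    _ = _ := by ring

/-- Abstract kernels with size, smoothness and cancellation. -/
structure GoodK (C r q : ℝ) (K : ℝ × ℝ → ℝ × ℝ → ℂ) : Prop where
  cont : Continuous (Function.uncurry K)
  supp : HasCompactSupport (Function.uncurry K)
  size : ∀ x y, ‖K x y‖ ≤ C * Wt 5 r q (x - y)
  d1 : ∀ x y : ℝ × ℝ, ∃ D, HasDerivAt (fun v => K x (v, y.2)) D y.1 ∧
    ‖D‖ ≤ C * r * Wt 2 r q (x - y)
  d2 : ∀ x y : ℝ × ℝ, ∃ D, HasDerivAt (fun v => K x (y.1, v)) D y.2 ∧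
    ‖D‖ ≤ C * q * Wt 2 r q (x - y)
  canc : ∀ x, ‖∫ y, K x y‖ ≤ C * r⁻¹

lemma mvt_aux (f : ℝ → ℂ) (B a b : ℝ)
    (h : ∀ s, |s - a| ≤ |b - a| → ∃ D, HasDerivAt f D s ∧ ‖D‖ ≤ B) : ‖f b - f a‖ ≤ B * |b - a| := by
  choose! f' hf' using h
  have hmem : ∀ s ∈ Set.uIcc a b, |s - a| ≤ |b - a| := fun s hs => Set.abs_sub_left_of_mem_uIcc hs
  have := (convex_uIcc a b).norm_image_sub_le_of_norm_hasDerivWithin_le (f := f) (f' := f') (C := B)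
    (fun s hs => (hf' s (hmem s hs)).1.hasDerivWithinAt) (fun s hs => (hf' s (hmem s hs)).2)
    Set.left_mem_uIcc Set.right_mem_uIcc
  simpa using this

lemma GoodK.diff {C r q : ℝ} {K : ℝ × ℝ → ℝ × ℝ → ℂ} (h : GoodK C r q K) (hC : 0 ≤ C)
    (hr : 0 < r) (hq : 0 < q) (x y z : ℝ × ℝ) :
    ‖K x y - K x z‖ ≤ C * (r * |z.1 - y.1| + q * |z.2 - y.2|) *
      ((1 + r * |z.1 - y.1|) ^ 2 * (1 + q * |z.2 - y.2|) ^ 2) * Wt 2 r q (x - z) := by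
  have hW : 0 ≤ Wt 2 r q (x - z) := Wt_nonneg hr hq
  set E := (1 + r * |z.1 - y.1|) ^ 2 * (1 + q * |z.2 - y.2|) ^ 2 with hE
  have a1 : ‖K x (y.1, y.2) - K x (z.1, y.2)‖ ≤ C * r * (E * Wt 2 r q (x - z)) * |y.1 - z.1| := by
    apply mvt_aux (fun v => K x (v, y.2))
    intro s hs
    obtain ⟨D, hD, hb⟩ := h.d1 x (s, y.2)
    refine ⟨D, hD, hb.trans ?_⟩
    gcongr
    have := Wt_peetre hr hq (x - z) (z.1 - s, z.2 - y.2) (|z.1 - y.1|) (|z.2 - y.2|)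
      (by simpa [abs_sub_comm] using hs) le_rfl
    have e : x - (s, y.2) = x - z + (z.1 - s, z.2 - y.2) := by
      ext <;> simp
    rw [e]; exact this
  have a2 : ‖K x (z.1, y.2) - K x (z.1, z.2)‖ ≤ C * q * (E * Wt 2 r q (x - z)) * |y.2 - z.2| := by
    apply mvt_aux (fun v => K x (z.1, v))
    intro s hs
    obtain ⟨D, hD, hb⟩ := h.d2 x (z.1, s)
    refine ⟨D, hD, hb.trans ?_⟩
    gcongr
    have := Wt_peetre hr hq (x - z) (0, z.2 - s) (|z.1 - y.1|) (|z.2 - y.2|)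
      (by simp) (by simpa [abs_sub_comm] using hs)
    have e : x - (z.1, s) = x - z + (0, z.2 - s) := by
      ext <;> simp
    rw [e]; exact this
  have a3 : ‖K x y - K x z‖ ≤ ‖K x (y.1, y.2) - K x (z.1, y.2)‖ + ‖K x (z.1, y.2) - K x (z.1, z.2)‖ := by
    refine le_trans (le_of_eq ?_) (norm_add_le _ _)
    simp
  rw [abs_sub_comm] at a1 a2
  refine a3.trans ((add_le_add a1 a2).trans (le_of_eq ?_))
  ring

lemma weight_absorb {r q r' q' ρ : ℝ} (hr : 0 < r) (hq : 0 < q) (hr' : 0 < r') (hq' : 0 < q')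
    (hρ0 : 0 < ρ) (hρ1 : ρ ≤ 1) (h1 : r ≤ ρ * r') (h2 : q ≤ ρ * q') (s t : ℝ) :
    (r * |s| + q * |t|) * ((1 + r * |s|) ^ 2 * (1 + q * |t|) ^ 2) * Wt 5 r' q' (s, t)
      ≤ ρ * Wt 2 r' q' (s, t) := by
  set X := r' * |s| with hX
  set Y := q' * |t| with hY
  have hX0 : 0 ≤ X := by positivity
  have hY0 : 0 ≤ Y := by positivity
  have e1 : r * |s| ≤ ρ * X := by rw [hX, ← mul_assoc]; gcongr
  have e2 : q * |t| ≤ ρ * Y := by rw [hY, ← mul_assoc]; gcongr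
  have e1' : r * |s| ≤ X := e1.trans (mul_le_of_le_one_left hX0 hρ1)
  have e2' : q * |t| ≤ Y := e2.trans (mul_le_of_le_one_left hY0 hρ1)
  have f1 : r * |s| + q * |t| ≤ ρ * ((1 + X) * (1 + Y)) := by
    have : X + Y ≤ (1 + X) * (1 + Y) := by nlinarith [mul_nonneg hX0 hY0]
    nlinarith
  have hw : 0 ≤ Wt 5 r' q' (s, t) := Wt_nonneg hr' hq'
  calc _ ≤ (ρ * ((1 + X) * (1 + Y))) * ((1 + X) ^ 2 * (1 + Y) ^ 2) * Wt 5 r' q' (s, t) := by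
        gcongr
    _ = _ := by
        simp only [Wt, wt, ← hX, ← hY]
        field_simp

lemma pair_bound {C r q r' q' ρ : ℝ} {K L : ℝ × ℝ → ℝ × ℝ → ℂ} (hK : GoodK C r q K)
    (hL : GoodK C r' q' L) (hC : 0 ≤ C) (hr : 0 < r) (hq : 0 < q) (hr' : 0 < r') (hq' : 0 < q')
    (hρ0 : 0 < ρ) (hρ1 : ρ ≤ 1) (h1 : r ≤ ρ * r') (h2 : q ≤ ρ * q') (h3 : r'⁻¹ ≤ ρ)
    (x z : ℝ × ℝ) :
    ‖prodK K L x z‖ ≤ (C ^ 2 * (Iw ^ 2 + 1) * ρ) * Wt 2 r q (x - z) := by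
  have hW : 0 ≤ Wt 2 r q (x - z) := Wt_nonneg hr hq
  have iL := cpt_integrable hL.cont hL.supp z
  have iLc : Integrable fun y => starRingEnd ℂ (L z y) := by
    exact (RCLike.conjCLE (K := ℂ)).toContinuousLinearMap.integrable_comp iL
  have hLb : ∃ B : ℝ, ∀ y, ‖K x y‖ ≤ B := by
    obtain ⟨B, hB⟩ := cpt_bdd hK.cont hK.supp
    exact ⟨B, hB x⟩
  obtain ⟨B, hB⟩ := hLb
  have hKc : Continuous (K x) := hK.cont.comp (by fun_prop : Continuous fun y => (x, y))
  have i1 : Integrable fun y => (K x y - K x z) * starRingEnd ℂ (L z y) := by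
    refine iLc.bdd_mul (c := B + B) (hKc.sub continuous_const).aestronglyMeasurable ?_
    exact Eventually.of_forall fun y => (norm_sub_le _ _).trans (add_le_add (hB _) (hB _))
  have i2 : Integrable fun y => K x z * starRingEnd ℂ (L z y) := iLc.const_mul _
  have e : prodK K L x z = (∫ y, (K x y - K x z) * starRingEnd ℂ (L z y))
      + K x z * starRingEnd ℂ (∫ y, L z y) := by
    rw [← integral_conj, ← integral_const_mul, ← integral_add i1 i2]
    unfold prodK
    congr 1; funext y; ring
  have b1 : ‖∫ y, (K x y - K x z) * starRingEnd ℂ (L z y)‖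
      ≤ ∫ y, (C ^ 2 * ρ * Wt 2 r q (x - z)) * Wt 2 r' q' (z - y) := by
    refine norm_integral_le_of_norm_le ((Wt_integrable_sub hr' hq' z).const_mul _) ?_
    refine Eventually.of_forall fun y => ?_
    rw [norm_mul, RCLike.norm_conj]
    have d := hK.diff hC hr hq x y z
    have s := hL.size z y
    have ab := weight_absorb hr hq hr' hq' hρ0 hρ1 h1 h2 (z.1 - y.1) (z.2 - y.2)
    have ez : z - y = (z.1 - y.1, z.2 - y.2) := rfl
    rw [← ez] at ab
    have hw : 0 ≤ Wt 5 r' q' (z - y) := Wt_nonneg hr' hq'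
    calc _ ≤ _ := mul_le_mul d s (norm_nonneg _) (by positivity)
      _ = (C ^ 2 * Wt 2 r q (x - z)) * ((r * |z.1 - y.1| + q * |z.2 - y.2|) *
          ((1 + r * |z.1 - y.1|) ^ 2 * (1 + q * |z.2 - y.2|) ^ 2) * Wt 5 r' q' (z - y)) := by ring
      _ ≤ (C ^ 2 * Wt 2 r q (x - z)) * (ρ * Wt 2 r' q' (z - y)) := by gcongr
      _ = _ := by ring
  rw [integral_const_mul, Wt_integral_sub hr' hq'] at b1
  have b2 : ‖K x z * starRingEnd ℂ (∫ y, L z y)‖ ≤ (C * Wt 2 r q (x - z)) * (C * ρ) := by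
    rw [norm_mul, RCLike.norm_conj]
    refine mul_le_mul ((hK.size x z).trans ?_) ((hL.canc z).trans ?_) (norm_nonneg _) (by positivity)
    · gcongr; exact Wt_mono (by norm_num) hr hq
    · gcongr
  rw [e]
  refine (norm_add_le _ _).trans ((add_le_add b1 b2).trans (le_of_eq ?_))
  ring

lemma lint_bound {r q c : ℝ} (hr : 0 < r) (hq : 0 < q) (hc : 0 ≤ c) (F : ℝ × ℝ → ℂ) (x : ℝ × ℝ)
    (h : ∀ y, ‖F y‖ ≤ c * Wt 2 r q (x - y)) : ∫⁻ y, ‖F y‖ₑ ≤ ENNReal.ofReal (c * Iw ^ 2) := by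
  have := Wt_integrable_sub hr hq x
  calc ∫⁻ y, ‖F y‖ₑ ≤ ∫⁻ y, ENNReal.ofReal (c * Wt 2 r q (x - y)) := by
        refine lintegral_mono fun y => ?_
        rw [← ofReal_norm]
        exact ENNReal.ofReal_le_ofReal (h y)
    _ = ENNReal.ofReal (∫ y, c * Wt 2 r q (x - y)) := by
        rw [ofReal_integral_eq_lintegral_ofReal (this.const_mul c)]
        exact Eventually.of_forall fun y => mul_nonneg hc (Wt_nonneg hr hq)
    _ = _ := by rw [integral_const_mul, Wt_integral_sub hr hq]

/-- Fine estimate (either order). -/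
lemma opNorm_fine {C r q r' q' ρ : ℝ} {K L : ℝ × ℝ → ℝ × ℝ → ℂ} (hK : GoodK C r q K)
    (hL : GoodK C r' q' L) (hC : 0 ≤ C) (hr : 0 < r) (hq : 0 < q) (hr' : 0 < r') (hq' : 0 < q')
    (hρ0 : 0 < ρ) (hρ1 : ρ ≤ 1) (h1 : r ≤ ρ * r') (h2 : q ≤ ρ * q') (h3 : r'⁻¹ ≤ ρ) :
    opNorm 2 (fun f => opK K (opK (adjK L) f))
        ≤ ENNReal.ofReal (C ^ 2 * (Iw ^ 2 + 1) * ρ * Iw ^ 2) ∧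
    opNorm 2 (fun f => opK L (opK (adjK K) f))
        ≤ ENNReal.ofReal (C ^ 2 * (Iw ^ 2 + 1) * ρ * Iw ^ 2) := by
  have pb := pair_bound hK hL hC hr hq hr' hq' hρ0 hρ1 h1 h2 h3
  have hc : 0 ≤ C ^ 2 * (Iw ^ 2 + 1) * ρ := by positivity
  constructor
  · apply opNorm_le_of
    intro f hf hfs
    rw [opK_comp K L hK.cont hK.supp hL.cont f hf hfs]
    refine schur_test _ (prodK_meas K L hK.cont hL.cont) _ ?_ ?_ f hf.measurable
    · exact fun x => lint_bound hr hq hc _ x (pb x)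
    · exact fun z => lint_bound hr hq hc _ z (fun x => by rw [Wt_symm]; exact pb x z)
  · apply opNorm_le_of
    intro f hf hfs
    rw [opK_comp L K hL.cont hL.supp hK.cont f hf hfs]
    refine schur_test _ (prodK_meas L K hL.cont hK.cont) _ ?_ ?_ f hf.measurable
    · exact fun z => lint_bound hr hq hc _ z (fun x => by rw [prodK_swap, Wt_symm]; exact pb x z)
    · exact fun x => lint_bound hr hq hc _ x (fun z => by rw [prodK_swap]; exact pb x z)

/-- Crude estimate. -/
lemma opNorm_crude {C r q r' q' : ℝ} {K L : ℝ × ℝ → ℝ × ℝ → ℂ} (hK : GoodK C r q K)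
    (hL : GoodK C r' q' L) (hC : 0 ≤ C) (hr : 0 < r) (hq : 0 < q) (hr' : 0 < r') (hq' : 0 < q') :
    opNorm 2 (fun f => opK K (opK (adjK L) f)) ≤ ENNReal.ofReal ((C * Iw ^ 2) ^ 2) := by
  apply opNorm_le_of
  intro f hf hfs
  have hLm : Continuous (Function.uncurry (adjK L)) := by
    exact Complex.continuous_conj.comp (hL.cont.comp continuous_swap)
  have sK : ∀ x y, ‖K x y‖ ≤ C * Wt 2 r q (x - y) := fun x y =>
    (hK.size x y).trans (by gcongr; exact Wt_mono (by norm_num) hr hq)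
  have sL : ∀ x y, ‖L x y‖ ≤ C * Wt 2 r' q' (x - y) := fun x y =>
    (hL.size x y).trans (by gcongr; exact Wt_mono (by norm_num) hr' hq')
  have m : Measurable (opK (adjK L) f) := by
    have c : Continuous (fun p : (ℝ × ℝ) × (ℝ × ℝ) => adjK L p.1 p.2 * f p.2) :=
      hLm.mul (hf.comp continuous_snd)
    exact (c.stronglyMeasurable.integral_prod_right (ν := volume)).measurable
  have t1 := schur_test K hK.cont.measurable _ (fun x => lint_bound hr hq hC _ x (sK x))
    (fun z => lint_bound hr hq hC _ z (fun x => by rw [Wt_symm]; exact sK x z)) _ m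
  have t2 := schur_test (adjK L) hLm.measurable _
    (fun x => lint_bound hr' hq' hC _ x (fun z => by
      unfold adjK; rw [RCLike.norm_conj, Wt_symm]; exact sL z x))
    (fun z => lint_bound hr' hq' hC _ z (fun x => by
      unfold adjK; rw [RCLike.norm_conj]; exact sL z x)) f hf.measurable
  calc _ ≤ _ := t1
    _ ≤ ENNReal.ofReal (C * Iw ^ 2) * (ENNReal.ofReal (C * Iw ^ 2) * eLpNorm f 2 volume) := by
        gcongr
    _ = _ := by
        rw [← mul_assoc, ← ENNReal.ofReal_mul (by positivity), ← sq]

/-- auxiliary constant -/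
def Bc (C : ℝ) : ℝ := 243 * (1 + C) ^ 5

/-- auxiliary constant -/
def Cc (C : ℝ) : ℝ := 3 * C ^ 4 * Bc C * (Iw ^ 2 + 1) + C ^ 2

lemma weight_loc {C r q s t θ : ℝ} (hC : 1 ≤ C) (hr : 0 < r) (hq : 0 < q) (h1 : r * |s| ≤ 2)
    (h2 : q * |t| ≤ q * |θ| + C) :
    r * (q * ((1 + |q * θ|) ^ 5)⁻¹) ≤ Bc C * Wt 5 r q (s, t) := by
  have a1 : r ≤ 243 * wt 5 r s := by
    unfold wt
    have : (1 + r * |s|) ^ 5 ≤ 243 := by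
      have : 1 + r * |s| ≤ 3 := by linarith
      calc (1 + r * |s|) ^ 5 ≤ 3 ^ 5 := by gcongr
        _ = 243 := by norm_num
    rw [← mul_assoc, mul_comm 243 r, mul_assoc]
    refine le_mul_of_one_le_right hr.le ?_
    rw [← div_eq_mul_inv, one_le_div (by positivity)]
    exact this
  have a2 : q * ((1 + |q * θ|) ^ 5)⁻¹ ≤ (1 + C) ^ 5 * wt 5 q t := by
    unfold wt
    rw [mul_left_comm]
    gcongr
    rw [← div_eq_mul_inv, le_div_iff₀ (by positivity), inv_mul_le_iff₀ (by positivity), ← mul_pow]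
    gcongr
    rw [abs_mul, abs_of_pos hq]
    have : 0 ≤ q * |θ| := by positivity
    nlinarith
  unfold Bc Wt
  calc _ ≤ (243 * wt 5 r s) * ((1 + C) ^ 5 * wt 5 q t) :=
        mul_le_mul a1 a2 (by positivity) (mul_nonneg (by norm_num) (wt_nonneg hr))
    _ = _ := by ring

lemma deriv_aux {C q : ℝ} (hq : 0 < q) (ψ ψ' : ℝ → ℂ)
    (hψ : ∀ s, HasDerivAt ψ (ψ' s) s)
    (hψb : ∀ s, ‖ψ s‖ ≤ C * ((1 + |s|) ^ 5)⁻¹)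
    (hψb' : ∀ s, ‖ψ' s‖ ≤ C * ((1 + |s|) ^ 5)⁻¹)
    (u p θ : ℝ → ℝ) (u' p' θ' v : ℝ) (hu : HasDerivAt u u' v) (hp : HasDerivAt p p' v)
    (hθ : HasDerivAt θ θ' v) :
    ∃ D, HasDerivAt (fun v => ((u v * p v : ℝ) : ℂ) * ((q : ℂ) * ψ (q * θ v))) D v ∧
      ‖D‖ ≤ (|u'| * |p v| + |u v| * |p'| + |u v| * |p v| * (q * |θ'|)) *
        (C * (q * ((1 + |q * θ v|) ^ 5)⁻¹)) := by
  have h1 : HasDerivAt (fun v => ((u v * p v : ℝ) : ℂ)) ((u' * p v + u v * p' : ℝ) : ℂ) v :=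
    (hu.mul hp).ofReal_comp
  have h2 : HasDerivAt (fun v => ψ (q * θ v)) ((q * θ') • ψ' (q * θ v)) v :=
    HasDerivAt.scomp v (hψ (q * θ v)) (hθ.const_mul q)
  refine ⟨_, h1.mul (h2.const_mul (q : ℂ)), ?_⟩
  set N := C * (q * ((1 + |q * θ v|) ^ 5)⁻¹) with hN
  have n1 : ‖(q : ℂ) * ψ (q * θ v)‖ ≤ N := by
    rw [norm_mul, Complex.norm_real, Real.norm_of_nonneg hq.le, hN, mul_left_comm]
    gcongr; exact hψb _
  have n2 : ‖(q : ℂ) * ((q * θ') • ψ' (q * θ v))‖ ≤ (q * |θ'|) * N := by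
    rw [norm_mul, Complex.norm_real, Real.norm_of_nonneg hq.le, norm_smul, Real.norm_eq_abs, abs_mul,
      abs_of_pos hq, hN]
    have := hψb' (q * θ v)
    calc _ ≤ q * (q * |θ'| * (C * ((1 + |q * θ v|) ^ 5)⁻¹)) := by gcongr
      _ = _ := by ring
  have N0 : 0 ≤ N := (norm_nonneg _).trans n1
  have m1 : ‖((u' * p v + u v * p' : ℝ) : ℂ)‖ ≤ |u'| * |p v| + |u v| * |p'| := by
    rw [Complex.norm_real, Real.norm_eq_abs]
    refine (abs_add_le _ _).trans (le_of_eq ?_)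
    rw [abs_mul, abs_mul]
  have m2 : ‖((u v * p v : ℝ) : ℂ)‖ = |u v| * |p v| := by
    rw [Complex.norm_real, Real.norm_eq_abs, abs_mul]
  refine (norm_add_le _ _).trans ?_
  rw [norm_mul ((u' * p v + u v * p' : ℝ) : ℂ), norm_mul ((u v * p v : ℝ) : ℂ), m2]
  calc _ ≤ (|u'| * |p v| + |u v| * |p'|) * N + |u v| * |p v| * ((q * |θ'|) * N) := by
        gcongr
    _ = _ := by ring

lemma goodK_of {C r q : ℝ} (hC : 1 ≤ C) (hr : 1 ≤ r) (hq : 0 < q) (hrq : r ≤ C * q)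
    (X : ℝ × ℝ → ℝ × ℝ → ℝ) (hXc : Continuous (Function.uncurry X))
    (hXs : HasCompactSupport (Function.uncurry X)) (hXb : ∀ x y, |X x y| ≤ C)
    (hXd : ∀ x y, DifferentiableAt ℝ (X x) y ∧ ‖fderiv ℝ (X x) y‖ ≤ C)
    (φ φ' : ℝ → ℝ) (hφ : ∀ s, HasDerivAt φ (φ' s) s) (hφb : ∀ s, |φ s| ≤ C)
    (hφb' : ∀ s, |φ' s| ≤ C) (hφs : ∀ s, φ s ≠ 0 → |s| < 2) (hφs' : ∀ s, φ' s ≠ 0 → |s| ≤ 2)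
    (ψ ψ' : ℝ → ℂ) (hψ : ∀ s, HasDerivAt ψ (ψ' s) s)
    (hψb : ∀ s, ‖ψ s‖ ≤ C * ((1 + |s|) ^ 5)⁻¹)
    (hψb' : ∀ s, ‖ψ' s‖ ≤ C * ((1 + |s|) ^ 5)⁻¹)
    (θ : ℝ × ℝ → ℝ × ℝ → ℝ) (hθc : Continuous (Function.uncurry θ))
    (hθ : ∀ x y : ℝ × ℝ, r * |x.1 - y.1| ≤ 2 → q * |x.2 - y.2| ≤ q * |θ x y| + C)
    (hθ1 : ∀ x y : ℝ × ℝ, ∃ D, HasDerivAt (fun v => θ x (v, y.2)) D y.1 ∧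
      (r * |x.1 - y.1| < 2 → q * |D| ≤ C * r))
    (hθ2 : ∀ x y : ℝ × ℝ, ∃ D, HasDerivAt (fun v => θ x (y.1, v)) D y.2 ∧
      (r * |x.1 - y.1| < 2 → |D| ≤ C))
    (K : ℝ × ℝ → ℝ × ℝ → ℂ)
    (hK : ∀ x y : ℝ × ℝ, K x y = ((X x y * (r * φ (r * (x.1 - y.1))) : ℝ) : ℂ) *
      ((q : ℂ) * ψ (q * θ x y)))
    (hcanc : ∀ x : ℝ × ℝ, ‖∫ y : ℝ × ℝ, ((r * φ (r * (x.1 - y.1)) : ℝ) : ℂ) *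
      ((q : ℂ) * ψ (q * θ x y))‖ ≤ C * r⁻¹) :
    GoodK (Cc C) r q K := by
  have hr0 : 0 < r := by linarith
  have hC0 : 0 < C := by linarith
  have hB : 1 ≤ Bc C := by
    unfold Bc
    have : 1 ≤ (1 + C) ^ 5 := one_le_pow₀ (by linarith)
    linarith
  have hC4 : 1 ≤ C ^ 4 := one_le_pow₀ hC
  have hCC : 3 * C ^ 4 * Bc C ≤ Cc C := by
    unfold Cc
    have h1 : 0 ≤ 3 * C ^ 4 * Bc C * Iw ^ 2 := by positivity
    have h2 : 0 ≤ C ^ 2 := by positivity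
    nlinarith
  have hwl : ∀ x y : ℝ × ℝ, r * |x.1 - y.1| ≤ 2 →
      r * (q * ((1 + |q * θ x y|) ^ 5)⁻¹) ≤ Bc C * Wt 5 r q (x - y) := fun x y h =>
    weight_loc hC hr0 hq h (hθ x y h)
  have habs : ∀ s : ℝ, |r * s| = r * |s| := fun s => by rw [abs_mul, abs_of_pos hr0]
  -- size of P
  have hP : ∀ x y : ℝ × ℝ, ‖((r * φ (r * (x.1 - y.1)) : ℝ) : ℂ) * ((q : ℂ) * ψ (q * θ x y))‖
      ≤ C ^ 2 * Bc C * Wt 5 r q (x - y) := by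
    intro x y
    have hw : 0 ≤ Wt 5 r q (x - y) := Wt_nonneg hr0 hq
    by_cases h : φ (r * (x.1 - y.1)) = 0
    · simp only [h]; simp; positivity
    · have h' := hφs _ h
      rw [habs] at h'
      have := hwl x y h'.le
      rw [norm_mul, norm_mul, Complex.norm_real, Complex.norm_real, Real.norm_of_nonneg hq.le,
        Real.norm_eq_abs, abs_mul, abs_of_pos hr0]
      calc _ ≤ r * C * (q * (C * ((1 + |q * θ x y|) ^ 5)⁻¹)) := by
            gcongr
            · exact hφb _
            · exact hψb _
        _ = C ^ 2 * (r * (q * ((1 + |q * θ x y|) ^ 5)⁻¹)) := by ring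
        _ ≤ C ^ 2 * (Bc C * Wt 5 r q (x - y)) := by gcongr
        _ = _ := by ring
  have hφc : Continuous φ := continuous_iff_continuousAt.2 fun s => (hφ s).continuousAt
  have hψc : Continuous ψ := continuous_iff_continuousAt.2 fun s => (hψ s).continuousAt
  have hPc : Continuous (fun p : (ℝ × ℝ) × (ℝ × ℝ) =>
      ((r * φ (r * (p.1.1 - p.2.1)) : ℝ) : ℂ) * ((q : ℂ) * ψ (q * θ p.1 p.2))) := by
    have : Continuous (fun p : (ℝ × ℝ) × (ℝ × ℝ) => θ p.1 p.2) := hθc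
    fun_prop
  have hKe : ∀ x y : ℝ × ℝ, K x y = (X x y : ℂ) * (((r * φ (r * (x.1 - y.1)) : ℝ) : ℂ) *
      ((q : ℂ) * ψ (q * θ x y))) := by
    intro x y; rw [hK]; push_cast; ring
  -- the derivative estimates
  have hN : ∀ (x y : ℝ × ℝ), 0 ≤ C * (q * ((1 + |q * θ x y|) ^ 5)⁻¹) := fun x y => by positivity
  have hX1 : ∀ x y : ℝ × ℝ, ∃ D, HasDerivAt (fun v => X x (v, y.2)) D y.1 ∧ |D| ≤ C := by
    intro x y
    have h1 : HasDerivAt (fun v : ℝ => (v, y.2)) ((1 : ℝ), (0 : ℝ)) y.1 :=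
      (hasDerivAt_id y.1).prodMk (hasDerivAt_const _ _)
    refine ⟨_, HasFDerivAt.comp_hasDerivAt (f := fun v : ℝ => (v, y.2)) y.1 (hXd x y).1.hasFDerivAt h1, ?_⟩
    refine ((fderiv ℝ (X x) y).le_opNorm _).trans ?_
    have : ‖((1 : ℝ), (0 : ℝ))‖ = 1 := by simp [Prod.norm_def]
    rw [this, mul_one]; exact (hXd x y).2
  have hX2 : ∀ x y : ℝ × ℝ, ∃ D, HasDerivAt (fun v => X x (y.1, v)) D y.2 ∧ |D| ≤ C := by
    intro x y
    have h1 : HasDerivAt (fun v : ℝ => (y.1, v)) ((0 : ℝ), (1 : ℝ)) y.2 :=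
      (hasDerivAt_const _ _).prodMk (hasDerivAt_id y.2)
    refine ⟨_, HasFDerivAt.comp_hasDerivAt (f := fun v : ℝ => (y.1, v)) y.2 (hXd x y).1.hasFDerivAt h1, ?_⟩
    refine ((fderiv ℝ (X x) y).le_opNorm _).trans ?_
    have : ‖((0 : ℝ), (1 : ℝ))‖ = 1 := by simp [Prod.norm_def]
    rw [this, mul_one]; exact (hXd x y).2
  have hXl : ∀ x y : ℝ × ℝ, |X x y - X x x| ≤ C * (|x.1 - y.1| + |x.2 - y.2|) := by
    intro x y
    have := convex_univ.norm_image_sub_le_of_norm_fderiv_le (𝕜 := ℝ) (f := X x) (C := C)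
      (fun z _ => (hXd x z).1) (fun z _ => (hXd x z).2) (mem_univ x) (mem_univ y)
    rw [Real.norm_eq_abs] at this
    refine this.trans ?_
    gcongr
    rw [Prod.norm_def]
    simp only [Prod.fst_sub, Prod.snd_sub, Real.norm_eq_abs]
    rw [abs_sub_comm y.1, abs_sub_comm y.2]
    exact max_le (by linarith [abs_nonneg (x.2 - y.2)]) (by linarith [abs_nonneg (x.1 - y.1)])
  constructor
  · have e : Function.uncurry K = fun p : (ℝ × ℝ) × (ℝ × ℝ) => ((X p.1 p.2 : ℝ) : ℂ) *
      (((r * φ (r * (p.1.1 - p.2.1)) : ℝ) : ℂ) * ((q : ℂ) * ψ (q * θ p.1 p.2))) := by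
      funext p; exact hKe p.1 p.2
    rw [e]
    exact (Complex.continuous_ofReal.comp hXc).mul hPc
  · refine HasCompactSupport.intro hXs.isCompact ?_
    rintro ⟨x, y⟩ h
    have : X x y = 0 := image_eq_zero_of_notMem_tsupport (f := Function.uncurry X) h
    simp [hKe, this]
  · intro x y
    have hw : 0 ≤ Wt 5 r q (x - y) := Wt_nonneg hr0 hq
    rw [hKe, norm_mul, Complex.norm_real, Real.norm_eq_abs]
    calc _ ≤ C * (C ^ 2 * Bc C * Wt 5 r q (x - y)) :=
          mul_le_mul (hXb x y) (hP x y) (norm_nonneg _) hC0.le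
      _ = C ^ 3 * Bc C * Wt 5 r q (x - y) := by ring
      _ ≤ (3 * C ^ 4 * Bc C) * Wt 5 r q (x - y) := by
          gcongr
          have : C ^ 3 ≤ C ^ 4 := pow_le_pow_right₀ hC (by norm_num)
          nlinarith
      _ ≤ _ := by gcongr
  · intro x y
    obtain ⟨X', hX', hX'b⟩ := hX1 x y
    obtain ⟨T', hT', hT'b⟩ := hθ1 x y
    have hp : HasDerivAt (fun v => r * φ (r * (x.1 - v))) (r * (φ' (r * (x.1 - y.1)) * (r * (-1)))) y.1 := by
      have : HasDerivAt (fun v => r * (x.1 - v)) (r * (-1)) y.1 :=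
        ((hasDerivAt_id y.1).const_sub x.1).const_mul r
      exact (HasDerivAt.comp y.1 (hφ (r * (x.1 - y.1))) this).const_mul r
    obtain ⟨D, hD, hDb⟩ := deriv_aux hq ψ ψ' hψ hψb hψb' _ _ _ _ _ _ _ hX' hp hT'
    refine ⟨D, ?_, hDb.trans ?_⟩
    · convert hD using 2 with v; exact hK x (v, y.2)
    have hw : 0 ≤ Wt 2 r q (x - y) := Wt_nonneg hr0 hq
    have hCc0 : 0 ≤ Cc C := le_trans (by positivity) hCC
    by_cases h : r * |x.1 - y.1| ≤ 2
    · have key : |X'| * |r * φ (r * (x.1 - y.1))| +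
          |X x (y.1, y.2)| * |r * (φ' (r * (x.1 - y.1)) * (r * (-1)))| +
          |X x (y.1, y.2)| * |r * φ (r * (x.1 - y.1))| * (q * |T'|) ≤ 3 * C ^ 3 * r * r := by
        have k1 : |r * φ (r * (x.1 - y.1))| ≤ r * C := by
          rw [habs]; gcongr; exact hφb _
        have k2 : |r * (φ' (r * (x.1 - y.1)) * (r * (-1)))| ≤ r * (C * r) := by
          rw [habs, abs_mul, abs_mul, abs_of_pos hr0]; simp only [abs_neg, abs_one, mul_one]
          gcongr; exact hφb' _
        have k3 : |r * φ (r * (x.1 - y.1))| * (q * |T'|) ≤ (r * C) * (C * r) := by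
          by_cases h0 : φ (r * (x.1 - y.1)) = 0
          · simp only [h0]; simp; positivity
          · have := hφs _ h0
            rw [habs] at this
            exact mul_le_mul k1 (hT'b this) (by positivity) (by positivity)
        have k4 := hXb x (y.1, y.2)
        have p1 : |X'| * |r * φ (r * (x.1 - y.1))| ≤ C * (r * C) := by gcongr
        have p2 : |X x (y.1, y.2)| * |r * (φ' (r * (x.1 - y.1)) * (r * (-1)))| ≤ C * (r * (C * r)) := by
          gcongr
        have p3 : |X x (y.1, y.2)| * |r * φ (r * (x.1 - y.1))| * (q * |T'|) ≤ C * ((r * C) * (C * r)) := by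
          rw [mul_assoc]; gcongr
        have q1 : C * (r * C) ≤ C ^ 3 * r * r := by
          have : (1:ℝ) ≤ C * r := by nlinarith
          nlinarith [mul_le_mul_of_nonneg_left this (by positivity : 0 ≤ C * (r * C))]
        have q2 : C * (r * (C * r)) ≤ C ^ 3 * r * r := by
          nlinarith [mul_le_mul_of_nonneg_left hC (by positivity : 0 ≤ C * (r * (C * r)))]
        nlinarith
      calc _ ≤ (3 * C ^ 3 * r * r) * (C * (q * ((1 + |q * θ x (y.1, y.2)|) ^ 5)⁻¹)) := by
            gcongr
        _ = 3 * C ^ 4 * r * (r * (q * ((1 + |q * θ x y|) ^ 5)⁻¹)) := by ring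
        _ ≤ 3 * C ^ 4 * r * (Bc C * Wt 5 r q (x - y)) := by exact mul_le_mul_of_nonneg_left (hwl x y h) (by positivity)
        _ ≤ 3 * C ^ 4 * r * (Bc C * Wt 2 r q (x - y)) := by
            gcongr; exact Wt_mono (by norm_num) hr0 hq
        _ = (3 * C ^ 4 * Bc C) * r * Wt 2 r q (x - y) := by ring
        _ ≤ _ := by gcongr
    · have z1 : φ (r * (x.1 - y.1)) = 0 := by
        by_contra h0
        have := hφs _ h0
        rw [habs] at this; linarith
      have z2 : φ' (r * (x.1 - y.1)) = 0 := by
        by_contra h0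
        have := hφs' _ h0
        rw [habs] at this; linarith
      simp only [z1, z2]
      simp; positivity
  · intro x y
    obtain ⟨X', hX', hX'b⟩ := hX2 x y
    obtain ⟨T', hT', hT'b⟩ := hθ2 x y
    have hp : HasDerivAt (fun _ : ℝ => r * φ (r * (x.1 - y.1))) 0 y.2 := hasDerivAt_const _ _
    obtain ⟨D, hD, hDb⟩ := deriv_aux hq ψ ψ' hψ hψb hψb' _ _ _ _ _ _ _ hX' hp hT'
    refine ⟨D, ?_, hDb.trans ?_⟩
    · convert hD using 2 with v; exact hK x (y.1, v)
    have hw : 0 ≤ Wt 2 r q (x - y) := Wt_nonneg hr0 hq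
    have hCc0 : 0 ≤ Cc C := le_trans (by positivity) hCC
    by_cases h0 : φ (r * (x.1 - y.1)) = 0
    · simp only [h0]; simp; positivity
    · have h := hφs _ h0
      rw [habs] at h
      have hT := hT'b h
      have key : |X'| * |r * φ (r * (x.1 - y.1))| +
          |X x (y.1, y.2)| * |(0:ℝ)| +
          |X x (y.1, y.2)| * |r * φ (r * (x.1 - y.1))| * (q * |T'|) ≤ 3 * C ^ 3 * r * q := by
        have k1 : |r * φ (r * (x.1 - y.1))| ≤ r * C := by
          rw [habs]; gcongr; exact hφb _
        have k4 := hXb x (y.1, y.2)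
        have p1 : |X'| * |r * φ (r * (x.1 - y.1))| ≤ C * (r * C) := by gcongr
        have p3 : |X x (y.1, y.2)| * |r * φ (r * (x.1 - y.1))| * (q * |T'|) ≤ C * (r * C) * (q * C) := by
          gcongr
        have q1 : C * (r * C) ≤ C ^ 3 * r * q := by
          have : (1:ℝ) ≤ C * q := by linarith
          nlinarith [mul_le_mul_of_nonneg_left this (by positivity : 0 ≤ C * (r * C))]
        have q3 : 0 ≤ C ^ 3 * r * q := by positivity
        rw [abs_zero, mul_zero]
        nlinarith
      calc _ ≤ (3 * C ^ 3 * r * q) * (C * (q * ((1 + |q * θ x (y.1, y.2)|) ^ 5)⁻¹)) := by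
            gcongr
        _ = 3 * C ^ 4 * q * (r * (q * ((1 + |q * θ x y|) ^ 5)⁻¹)) := by ring
        _ ≤ 3 * C ^ 4 * q * (Bc C * Wt 5 r q (x - y)) := by exact mul_le_mul_of_nonneg_left (hwl x y h.le) (by positivity)
        _ ≤ 3 * C ^ 4 * q * (Bc C * Wt 2 r q (x - y)) := by
            gcongr; exact Wt_mono (by norm_num) hr0 hq
        _ = (3 * C ^ 4 * Bc C) * q * Wt 2 r q (x - y) := by ring
        _ ≤ _ := by gcongr
  · intro x
    set P : ℝ × ℝ → ℂ := fun y => ((r * φ (r * (x.1 - y.1)) : ℝ) : ℂ) * ((q : ℂ) * ψ (q * θ x y)) with hPdef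
    have hPxc : Continuous P := hPc.comp (by fun_prop : Continuous fun y : ℝ × ℝ => (x, y))
    have iP : Integrable P := by
      refine Integrable.mono' ((Wt_integrable_sub hr0 hq x).const_mul (C ^ 2 * Bc C))
        hPxc.aestronglyMeasurable (Eventually.of_forall fun y => (hP x y).trans ?_)
      gcongr
      exact Wt_mono (by norm_num) hr0 hq
    have hXx : Continuous (X x) := hXc.comp (by fun_prop : Continuous fun y : ℝ × ℝ => (x, y))
    have i1 : Integrable fun y => ((X x y - X x x : ℝ) : ℂ) * P y := by
      refine iP.bdd_mul (c := C + C) (Complex.continuous_ofReal.comp (hXx.sub continuous_const)).aestronglyMeasurable ?_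
      refine Eventually.of_forall fun y => ?_
      rw [Complex.norm_real]
      exact (norm_sub_le _ _).trans (add_le_add (hXb _ _) (hXb _ _))
    have e : ∫ y, K x y = (∫ y, ((X x y - X x x : ℝ) : ℂ) * P y) + (X x x : ℂ) * ∫ y, P y := by
      rw [← integral_const_mul, ← integral_add i1 (iP.const_mul _)]
      congr 1; funext y
      rw [hKe]; simp only [hPdef]; push_cast; ring
    have b2 : ‖(X x x : ℂ) * ∫ y, P y‖ ≤ C * (C * r⁻¹) := by
      rw [norm_mul, Complex.norm_real]
      exact mul_le_mul (hXb x x) (hcanc x) (norm_nonneg _) hC0.le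
    have b1 : ‖∫ y, ((X x y - X x x : ℝ) : ℂ) * P y‖ ≤
        ∫ y, (C ^ 4 * Bc C * r⁻¹) * Wt 2 r q (x - y) := by
      refine norm_integral_le_of_norm_le ((Wt_integrable_sub hr0 hq x).const_mul _) ?_
      refine Eventually.of_forall fun y => ?_
      rw [norm_mul, Complex.norm_real, Real.norm_eq_abs]
      have ab := weight_absorb hr0 hq hr0 hq one_pos le_rfl (by linarith : r ≤ 1 * r)
        (by linarith : q ≤ 1 * q) (x.1 - y.1) (x.2 - y.2)
      have ez : x - y = (x.1 - y.1, x.2 - y.2) := rfl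
      rw [← ez, one_mul] at ab
      have hw : 0 ≤ Wt 5 r q (x - y) := Wt_nonneg hr0 hq
      have l1 : |x.1 - y.1| + |x.2 - y.2| ≤ C * r⁻¹ * (r * |x.1 - y.1| + q * |x.2 - y.2|) := by
        have t1 : |x.1 - y.1| ≤ C * r⁻¹ * (r * |x.1 - y.1|) := by
          have : C * r⁻¹ * (r * |x.1 - y.1|) = C * |x.1 - y.1| := by field_simp
          rw [this]; exact le_mul_of_one_le_left (abs_nonneg _) hC
        have t2 : |x.2 - y.2| ≤ C * r⁻¹ * (q * |x.2 - y.2|) := by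
          have : C * r⁻¹ * (q * |x.2 - y.2|) = ((C * q) / r) * |x.2 - y.2| := by field_simp
          rw [this]; exact le_mul_of_one_le_left (abs_nonneg _) ((one_le_div hr0).2 hrq)
        rw [mul_add]; exact add_le_add t1 t2
      have l2 : r * |x.1 - y.1| + q * |x.2 - y.2| ≤ (r * |x.1 - y.1| + q * |x.2 - y.2|) *
          ((1 + r * |x.1 - y.1|) ^ 2 * (1 + q * |x.2 - y.2|) ^ 2) := by
        refine le_mul_of_one_le_right (by positivity) (one_le_mul_of_one_le_of_one_le ?_ ?_)
        · exact one_le_pow₀ (by have : 0 ≤ r * |x.1 - y.1| := by positivity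
                                linarith)
        · exact one_le_pow₀ (by have : 0 ≤ q * |x.2 - y.2| := by positivity
                                linarith)
      calc _ ≤ (C * (|x.1 - y.1| + |x.2 - y.2|)) * (C ^ 2 * Bc C * Wt 5 r q (x - y)) :=
            mul_le_mul (hXl x y) (hP x y) (norm_nonneg _) (by positivity)
        _ ≤ (C * (C * r⁻¹ * ((r * |x.1 - y.1| + q * |x.2 - y.2|) *
          ((1 + r * |x.1 - y.1|) ^ 2 * (1 + q * |x.2 - y.2|) ^ 2)))) * (C ^ 2 * Bc C * Wt 5 r q (x - y)) := by
            gcongr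
            refine l1.trans ?_
            gcongr
        _ = (C ^ 4 * Bc C * r⁻¹) * ((r * |x.1 - y.1| + q * |x.2 - y.2|) *
          ((1 + r * |x.1 - y.1|) ^ 2 * (1 + q * |x.2 - y.2|) ^ 2) * Wt 5 r q (x - y)) := by ring
        _ ≤ _ := by gcongr
    rw [integral_const_mul, Wt_integral_sub hr0 hq] at b1
    rw [e]
    refine (norm_add_le _ _).trans ((add_le_add b1 b2).trans ?_)
    unfold Cc
    have : C ^ 4 * Bc C * r⁻¹ * Iw ^ 2 + C * (C * r⁻¹) = (C ^ 4 * Bc C * Iw ^ 2 + C ^ 2) * r⁻¹ := by ring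
    rw [this]
    gcongr ?_ * _
    have h1 : 0 ≤ C ^ 4 * Bc C * Iw ^ 2 := by positivity
    have h2 : 0 ≤ C ^ 4 * Bc C := by positivity
    nlinarith

lemma schwartz_decay (F : SchwartzMap ℝ ℂ) :
    ∃ C : ℝ, 0 ≤ C ∧ ∀ u : ℝ, ‖F (-(2 * Real.pi)⁻¹ * u)‖ ≤ C * ((1 + |u|) ^ 5)⁻¹ := by
  have h := fun x => SchwartzMap.one_add_le_sup_seminorm_apply (𝕜 := ℝ) (m := (5, 0)) (k := 5) (n := 0)
    le_rfl le_rfl F x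
  obtain ⟨c, hc⟩ : ∃ c : ℝ, ∀ x, (1 + ‖x‖) ^ 5 * ‖F x‖ ≤ c := ⟨_, fun x => by
    simpa [norm_iteratedFDeriv_zero] using h x⟩
  have hc0 : 0 ≤ c := le_trans (by positivity) (hc 0)
  refine ⟨(1 + 2 * Real.pi) ^ 5 * c, by positivity, fun u => ?_⟩
  rw [← div_eq_mul_inv, le_div_iff₀ (by positivity)]
  have := hc (-(2 * Real.pi)⁻¹ * u)
  have hp : 0 < 2 * Real.pi := by positivity
  have e : ‖-(2 * Real.pi)⁻¹ * u‖ = |u| / (2 * Real.pi) := by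
    rw [Real.norm_eq_abs, abs_mul, abs_neg, abs_of_pos (inv_pos.2 hp)]; field_simp
  rw [e] at this
  have h1 : (1 + |u|) ≤ (1 + 2 * Real.pi) * (1 + |u| / (2 * Real.pi)) := by
    have : (1 + 2 * Real.pi) * (1 + |u| / (2 * Real.pi)) = 1 + 2 * Real.pi + |u| / (2 * Real.pi) + |u| := by
      field_simp
      ring
    rw [this]
    have : 0 ≤ |u| / (2 * Real.pi) := by positivity
    linarith
  calc ‖F (-(2 * Real.pi)⁻¹ * u)‖ * (1 + |u|) ^ 5
      ≤ ‖F (-(2 * Real.pi)⁻¹ * u)‖ * ((1 + 2 * Real.pi) * (1 + |u| / (2 * Real.pi))) ^ 5 := by gcongr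
    _ = (1 + 2 * Real.pi) ^ 5 * ((1 + |u| / (2 * Real.pi)) ^ 5 * ‖F (-(2 * Real.pi)⁻¹ * u)‖) := by
        rw [mul_pow]; ring
    _ ≤ _ := by gcongr

lemma psi_exists (β0 : ℝ → ℝ) (hβ : IsBump β0) : ∃ (ψ ψ' : ℝ → ℂ) (C : ℝ),
    (∀ s, HasDerivAt ψ (ψ' s) s) ∧ (∀ s, ‖ψ s‖ ≤ C * ((1 + |s|) ^ 5)⁻¹) ∧
    (∀ s, ‖ψ' s‖ ≤ C * ((1 + |s|) ^ 5)⁻¹) ∧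
    ∀ (a : ℤ) (u : ℝ), (∫ τ : ℝ, ((β0 ((2:ℝ) ^ (-a) * τ) : ℝ) : ℂ) *
      Complex.exp (Complex.I * (τ : ℂ) * (u : ℂ))) = (((2:ℝ) ^ a : ℝ) : ℂ) * ψ ((2:ℝ) ^ a * u) := by
  have hs : HasCompactSupport (fun s => (β0 s : ℂ)) := by
    refine HasCompactSupport.intro (isCompact_Icc (a := (-1:ℝ)) (b := 1)) ?_
    intro s hs
    have : 1 ≤ |s| := by
      by_contra h
      push Not at h
      exact hs ⟨(abs_lt.1 h).1.le, (abs_lt.1 h).2.le⟩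
    simp [hβ.zero s (by linarith)]
  have hd : ContDiff ℝ (⊤ : ℕ∞) (fun s => (β0 s : ℂ)) := Complex.ofRealCLM.contDiff.comp hβ.smooth
  set f : SchwartzMap ℝ ℂ := hs.toSchwartzMap hd with hf
  set F : SchwartzMap ℝ ℂ := FourierTransform.fourier f with hF
  obtain ⟨C1, hC1, h1⟩ := schwartz_decay F
  obtain ⟨C2, hC2, h2⟩ := schwartz_decay (SchwartzMap.derivCLM ℝ ℂ F)
  have hp : 0 < 2 * Real.pi := by positivity
  have hψe : ∀ u : ℝ, F (-(2 * Real.pi)⁻¹ * u) = ∫ τ : ℝ, (β0 τ : ℂ) * Complex.exp (Complex.I * τ * u) := by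
    intro u
    rw [hF, SchwartzMap.fourier_coe, Real.fourier_real_eq_integral_exp_smul]
    congr 1; funext τ
    rw [smul_eq_mul, mul_comm]
    congr 2
    push_cast
    have : (Real.pi : ℂ) ≠ 0 := by exact_mod_cast Real.pi_ne_zero
    field_simp
  refine ⟨fun u => F (-(2 * Real.pi)⁻¹ * u),
    fun u => (-(2 * Real.pi)⁻¹) • SchwartzMap.derivCLM ℝ ℂ F (-(2 * Real.pi)⁻¹ * u), C1 + C2, ?_, ?_, ?_, ?_⟩
  · intro s
    have a1 : HasDerivAt F (deriv F (-(2 * Real.pi)⁻¹ * s)) (-(2 * Real.pi)⁻¹ * s) :=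
      F.differentiableAt.hasDerivAt
    have a2 : HasDerivAt (fun u => -(2 * Real.pi)⁻¹ * u) (-(2 * Real.pi)⁻¹) s := by
      simpa using (hasDerivAt_id s).const_mul (-(2 * Real.pi)⁻¹)
    exact HasDerivAt.scomp s a1 a2
  · intro s
    refine (h1 s).trans ?_
    gcongr; linarith
  · intro s
    rw [norm_smul]
    have : ‖-(2 * Real.pi)⁻¹‖ ≤ 1 := by
      rw [norm_neg, Real.norm_of_nonneg (inv_pos.2 hp).le]
      exact inv_le_one_of_one_le₀ (by nlinarith [Real.pi_gt_three])
    calc _ ≤ 1 * (C2 * ((1 + |s|) ^ 5)⁻¹) := by gcongr; exact h2 s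
      _ ≤ _ := by rw [one_mul]; gcongr; linarith
  · intro a u
    simp only [hψe]
    have h2a : (0:ℝ) < (2:ℝ) ^ a := by positivity
    have := Measure.integral_comp_mul_left (fun τ : ℝ => (β0 τ : ℂ) * Complex.exp (Complex.I * τ * (((2:ℝ)^a * u : ℝ) : ℂ))) ((2:ℝ) ^ (-a))
    rw [zpow_neg, inv_inv, abs_of_pos h2a] at this
    rw [Complex.real_smul] at this
    rw [zpow_neg, ← this]
    congr 1; funext τ
    congr 2
    push_cast
    have : (2:ℂ) ^ a ≠ 0 := zpow_ne_zero _ two_ne_zero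
    field_simp

lemma phi_facts (φ : ℝ → ℝ) (hφ : IsPhi φ) : ∃ (φ' : ℝ → ℝ) (C : ℝ),
    (∀ s, HasDerivAt φ (φ' s) s) ∧ (∀ s, |φ s| ≤ C) ∧ (∀ s, |φ' s| ≤ C) ∧
    (∀ s, φ s ≠ 0 → |s| < 2) ∧ (∀ s, φ' s ≠ 0 → |s| ≤ 2) := by
  have hs : HasCompactSupport φ := by
    refine HasCompactSupport.intro (isCompact_Icc (a := (-2:ℝ)) (b := 2)) ?_
    intro s hs
    by_contra h
    have := (hφ.supp s h).2
    exact hs ⟨(abs_lt.1 this).1.le, (abs_lt.1 this).2.le⟩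
  have hsub : tsupport φ ⊆ Icc (-2) 2 := by
    refine closure_minimal ?_ isClosed_Icc
    intro s h
    have := (hφ.supp s h).2
    exact ⟨(abs_lt.1 this).1.le, (abs_lt.1 this).2.le⟩
  have hdc : Continuous (deriv φ) := hφ.smooth.continuous_deriv (by simp)
  obtain ⟨C1, h1⟩ := hs.exists_bound_of_continuous hφ.smooth.continuous
  obtain ⟨C2, h2⟩ := hs.deriv.exists_bound_of_continuous hdc
  refine ⟨deriv φ, max C1 C2, ?_, ?_, ?_, fun s h => (hφ.supp s h).2, ?_⟩
  · intro s
    exact (hφ.smooth.differentiable (by simp) s).hasDerivAt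
  · exact fun s => (h1 s).trans (le_max_left _ _)
  · exact fun s => (h2 s).trans (le_max_right _ _)
  · intro s h
    have := hsub (support_deriv_subset h)
    exact abs_le.2 ⟨this.1, this.2⟩

lemma chi_facts (χ : ℝ × ℝ → ℝ × ℝ → ℝ) (hχ : IsChi χ) : ∃ C : ℝ,
    (∀ x y, |χ x y| ≤ C) ∧
    (∀ x y, DifferentiableAt ℝ (χ x) y ∧ ‖fderiv ℝ (χ x) y‖ ≤ C) ∧
    (∀ x y, DifferentiableAt ℝ (fun x => χ x y) x ∧ ‖fderiv ℝ (fun x => χ x y) x‖ ≤ C) := by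
  set X := fun p : (ℝ × ℝ) × (ℝ × ℝ) => χ p.1 p.2 with hX
  obtain ⟨C1, h1⟩ := hχ.cpt.exists_bound_of_continuous hχ.smooth.continuous
  have hdc : Continuous (fderiv ℝ X) := hχ.smooth.continuous_fderiv (by simp)
  obtain ⟨C2, h2⟩ := (hχ.cpt.fderiv ℝ).exists_bound_of_continuous hdc
  have hC2 : 0 ≤ C2 := (norm_nonneg _).trans (h2 0)
  have hd : ∀ p, HasFDerivAt X (fderiv ℝ X p) p := fun p =>
    (hχ.smooth.differentiable (by simp) p).hasFDerivAt
  refine ⟨max C1 C2, fun x y => (h1 (x, y)).trans (le_max_left _ _), ?_, ?_⟩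
  · intro x y
    have : HasFDerivAt (χ x) ((fderiv ℝ X (x, y)).comp (ContinuousLinearMap.inr ℝ (ℝ × ℝ) (ℝ × ℝ))) y :=
      (hd (x, y)).comp y (hasFDerivAt_prodMk_right x y)
    refine ⟨this.differentiableAt, ?_⟩
    rw [this.fderiv]
    refine (ContinuousLinearMap.opNorm_comp_le _ _).trans ?_
    calc _ ≤ C2 * 1 := by
          gcongr
          · exact h2 _
          · exact ContinuousLinearMap.norm_inr_le_one _ _ _
      _ ≤ _ := by rw [mul_one]; exact le_max_right _ _
  · intro x y
    have : HasFDerivAt (fun x => χ x y) ((fderiv ℝ X (x, y)).comp (ContinuousLinearMap.inl ℝ (ℝ × ℝ) (ℝ × ℝ))) x :=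
      HasFDerivAt.comp (g := X) (f := fun e => (e, y)) x (hd (x, y)) (hasFDerivAt_prodMk_left x y)
    refine ⟨this.differentiableAt, ?_⟩
    rw [this.fderiv]
    refine (ContinuousLinearMap.opNorm_comp_le _ _).trans ?_
    calc _ ≤ C2 * 1 := by
          gcongr
          · exact h2 _
          · exact ContinuousLinearMap.norm_inl_le_one _ _ _
      _ ≤ _ := by rw [mul_one]; exact le_max_right _ _

lemma qm_mono {c κ : ℝ} (hκ : 0 ≤ κ) (f f' a : ℝ → ℝ)
    (hf : ∀ t ∈ Icc (0:ℝ) c, HasDerivAt f (f' t) t)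
    (hE : ∀ t ∈ Icc (0:ℝ) c, |f' t - a t| ≤ κ * |f t|)
    (ha : ∀ t ∈ Ioc (0:ℝ) c, 0 ≤ a t) (f0 : f 0 = 0) (hne : ∀ t ∈ Ioc (0:ℝ) c, f t ≠ 0)
    {s t : ℝ} (hs : 0 ≤ s) (hst : s ≤ t) (ht : t ≤ c) :
    |f s| ≤ Real.exp (κ * c) * |f t| := by
  have hexp : ∀ (k u : ℝ), HasDerivAt (fun u => Real.exp (k * u)) (Real.exp (k * u) * k) u := by
    intro k u
    have := ((hasDerivAt_id u).const_mul k).exp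
    simpa using this
  have key : ∀ (k b : ℝ), b ≤ c → (∀ u ∈ Ioo (0:ℝ) b, 0 ≤ f' u + k * f u) →
      MonotoneOn (fun u => f u * Real.exp (k * u)) (Icc 0 b) := by
    intro k b hb h
    have hd : ∀ u ∈ Icc (0:ℝ) b, HasDerivAt (fun u => f u * Real.exp (k * u))
        (f' u * Real.exp (k * u) + f u * (Real.exp (k * u) * k)) u := fun u hu =>
      (hf u ⟨hu.1, hu.2.trans hb⟩).mul (hexp k u)
    apply monotoneOn_of_deriv_nonneg (convex_Icc 0 b)
    · exact fun u hu => (hd u hu).continuousAt.continuousWithinAt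
    · intro u hu
      rw [interior_Icc] at hu
      exact (hd u ⟨hu.1.le, hu.2.le⟩).differentiableAt.differentiableWithinAt
    · intro u hu
      rw [interior_Icc] at hu
      rw [(hd u ⟨hu.1.le, hu.2.le⟩).deriv]
      have := mul_nonneg (h u hu) (Real.exp_pos (k * u)).le
      linarith
  have hpos : ∀ t ∈ Ioc (0:ℝ) c, 0 < f t := by
    intro t ht
    by_contra hcon
    have hneg : f t < 0 := lt_of_le_of_ne (not_lt.1 hcon) (hne t ht)
    have hall : ∀ u ∈ Ioo (0:ℝ) t, f u < 0 := by
      intro u hu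
      by_contra hc2
      have hcont : ContinuousOn f (Icc u t) := fun v hv =>
        (hf v ⟨hu.1.le.trans hv.1, hv.2.trans ht.2⟩).continuousAt.continuousWithinAt
      have : (0:ℝ) ∈ f '' Icc u t :=
        intermediate_value_Icc' hu.2.le hcont ⟨hneg.le, not_lt.1 hc2⟩
      obtain ⟨v, hv, hv0⟩ := this
      exact hne v ⟨hu.1.trans_le hv.1, hv.2.trans ht.2⟩ hv0
    have := key (-κ) t ht.2 (by
      intro u hu
      have h1 := hall u hu
      have h2 := hE u ⟨hu.1.le, hu.2.le.trans ht.2⟩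
      have h3 := ha u ⟨hu.1, hu.2.le.trans ht.2⟩
      rw [abs_of_neg h1] at h2
      have := (abs_le.1 h2).1
      linarith) (left_mem_Icc.2 ht.1.le) (right_mem_Icc.2 ht.1.le) ht.1.le
    simp only [f0, zero_mul] at this
    have h4 := mul_neg_of_neg_of_pos hneg (Real.exp_pos (-κ * t))
    linarith
  have hm := key κ c le_rfl (by
      intro u hu
      have h1 := hpos u ⟨hu.1, hu.2.le⟩
      have h2 := hE u ⟨hu.1.le, hu.2.le⟩
      have h3 := ha u ⟨hu.1, hu.2.le⟩
      rw [abs_of_pos h1] at h2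
      have := (abs_le.1 h2).1
      linarith) ⟨hs, hst.trans ht⟩ ⟨hs.trans hst, ht⟩ hst
  simp only at hm
  have hnn : ∀ u ∈ Icc (0:ℝ) c, 0 ≤ f u := by
    intro u hu
    rcases eq_or_lt_of_le hu.1 with h | h
    · rw [← h, f0]
    · exact (hpos u ⟨h, hu.2⟩).le
  have fs := hnn s ⟨hs, hst.trans ht⟩
  have ft := hnn t ⟨hs.trans hst, ht⟩
  rw [abs_of_nonneg fs, abs_of_nonneg ft]
  calc f s ≤ f s * Real.exp (κ * s) :=
        le_mul_of_one_le_right fs (Real.one_le_exp (by positivity))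
    _ ≤ f t * Real.exp (κ * t) := hm
    _ ≤ f t * Real.exp (κ * c) := by gcongr
    _ = _ := mul_comm _ _

lemma gd_mono {c₀ A C₀ κ c₁ M : ℝ} {g : ℝ → ℝ} {γ γd γdd γ2 : ℝ × ℝ → ℝ → ℝ} (hA : 1 ≤ A)
    (hC₀ : 1 ≤ C₀) (hκ : 0 ≤ κ) (hg : IsDoubling g A)
    (h : CurveHyp c₀ A C₀ κ c₁ M g γ γd γdd γ2) (x : ℝ × ℝ) {t s : ℝ} (hts : |t| ≤ s)
    (hs : s ≤ c₀) : |γd x t| ≤ Real.exp (κ * c₀) * C₀ * g (A * s) := by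
  obtain ⟨a, E, h1, h2, h3, h4⟩ := h.qm
  have hs0 : 0 ≤ s := (abs_nonneg t).trans hts
  have hne : ∀ t, t ≠ 0 → |t| ≤ c₀ → γd x t ≠ 0 := by
    intro t ht htc h0
    have := (h.dbl x t htc).1
    rw [h0, abs_zero] at this
    have hp : 0 < g (A⁻¹ * |t|) := hg.pos _ (by have := abs_pos.2 ht; positivity)
    have : 0 < C₀⁻¹ * g (A⁻¹ * |t|) := by positivity
    linarith
  have fin : ∀ u, |u| = s → |γd x t| ≤ Real.exp (κ * c₀) * |γd x u| →
      |γd x t| ≤ Real.exp (κ * c₀) * C₀ * g (A * s) := by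
    intro u hu hh
    have := (h.dbl x u (hu.le.trans hs)).2
    rw [hu] at this
    calc _ ≤ _ := hh
      _ ≤ Real.exp (κ * c₀) * (C₀ * g (A * s)) := by gcongr
      _ = _ := by ring
  have hab : ∀ t ∈ Icc (0:ℝ) c₀, |t| ≤ c₀ := fun t ht => by rw [abs_of_nonneg ht.1]; exact ht.2
  have habn : ∀ t ∈ Icc (0:ℝ) c₀, |-t| ≤ c₀ := fun t ht => by rw [abs_neg]; exact hab t ht
  have hE : ∀ t, |t| ≤ c₀ → |γdd x t - a x t| ≤ κ * |γd x t| := by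
    intro t ht
    rw [h1 x t ht, add_sub_cancel_left]; exact h2 x t ht
  have hnegd : ∀ t ∈ Icc (0:ℝ) c₀, HasDerivAt (fun u => γd x (-u)) (-γdd x (-t)) t := by
    intro t ht
    exact ((h.deriv2 x (-t) (habn t ht)).comp t (hasDerivAt_neg t)).congr_deriv (by ring)
  rcases le_total 0 t with ht | ht
  · rw [abs_of_nonneg ht] at hts
    apply fin s (abs_of_nonneg hs0)
    rcases h3 x with h3 | h3
    · exact qm_mono hκ (γd x) (γdd x) (a x) (fun t ht => h.deriv2 x t (hab t ht))
        (fun t ht => hE t (hab t ht)) h3 (h.initd x)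
        (fun t ht => hne t ht.1.ne' (hab t ⟨ht.1.le, ht.2⟩)) ht hts hs
    · have := qm_mono hκ (fun u => -γd x u) (fun u => -γdd x u) (fun u => -a x u)
        (fun t ht => (h.deriv2 x t (hab t ht)).neg)
        (fun t ht => by
          have := hE t (hab t ht)
          rw [← abs_neg] at this
          rw [abs_neg (γd x t)]
          convert this using 2
          ring)
        (fun t ht => by have := h3 t ht; linarith) (by simp [h.initd x])
        (fun t ht => neg_ne_zero.2 (hne t ht.1.ne' (hab t ⟨ht.1.le, ht.2⟩))) ht hts hs
      simpa using this
  · rw [abs_of_nonpos ht] at hts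
    apply fin (-s) (by rw [abs_neg, abs_of_nonneg hs0])
    have ht' : 0 ≤ -t := by linarith
    rcases h4 x with h4 | h4
    · have := qm_mono hκ (fun u => -γd x (-u)) (fun u => γdd x (-u)) (fun u => a x (-u))
        (fun t ht => (hnegd t ht).neg.congr_deriv (neg_neg _))
        (fun t ht => by
          rw [abs_neg]; exact hE (-t) (habn t ht))
        (fun t ht => h4 (-t) ⟨by linarith [ht.2], by linarith [ht.1]⟩) (by simp [h.initd x])
        (fun t ht => neg_ne_zero.2 (hne (-t) (neg_ne_zero.2 ht.1.ne') (habn t ⟨ht.1.le, ht.2⟩)))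
        ht' hts hs
      simpa using this
    · have := qm_mono hκ (fun u => γd x (-u)) (fun u => -γdd x (-u)) (fun u => -a x (-u))
        hnegd
        (fun t ht => by
          have := hE (-t) (habn t ht)
          rw [← abs_neg] at this
          convert this using 2
          ring)
        (fun t ht => by
          have := h4 (-t) ⟨by linarith [ht.2], by linarith [ht.1]⟩
          linarith) (by simp [h.initd x])
        (fun t ht => (hne (-t) (neg_ne_zero.2 ht.1.ne') (habn t ⟨ht.1.le, ht.2⟩)))
        ht' hts hs
      simpa using this

lemma gd_bound {c₀ A C₀ κ c₁ M : ℝ} {g : ℝ → ℝ} {γ γd γdd γ2 : ℝ × ℝ → ℝ → ℝ} (hA : 1 ≤ A)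
    (hC₀ : 1 ≤ C₀) (hκ : 0 ≤ κ) (hg : IsDoubling g A)
    (h : CurveHyp c₀ A C₀ κ c₁ M g γ γd γdd γ2) (a : ℤ → ℤ) (ha : ajSpec g A a) :
    ∃ C : ℝ, 1 ≤ C ∧ ∀ j : ℤ, 1 ≤ j → (2:ℝ) ^ (-j + 1) ≤ c₀ → ∀ x t,
      (2:ℝ) ^ j * |t| ≤ 2 → (2:ℝ) ^ a j * |γd x t| ≤ C * (2:ℝ) ^ j := by
  have hc0 := h.c₀_pos
  have hA0 : 0 < A := by linarith
  obtain ⟨m, hm, hmin⟩ := (isCompact_Icc (a := A * c₀) (b := A * c₀ + 2 ^ 14 * A)).exists_isMinOn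
    (nonempty_Icc.2 (by linarith)) (hg.cont.mono (fun u hu => le_trans (by positivity) hu.1))
  obtain ⟨N, hN, hmax⟩ := (isCompact_Icc (a := 0) (b := A * c₀)).exists_isMaxOn
    (nonempty_Icc.2 (by positivity)) (hg.cont.mono (fun u hu => hu.1))
  have hgm : 0 < g m := hg.pos m (lt_of_lt_of_le (by positivity) hm.1)
  have hexp : 1 ≤ Real.exp (κ * c₀) := Real.one_le_exp (by positivity)
  have hgN : 0 ≤ g N := by
    have := hmax (left_mem_Icc.2 (by positivity : 0 ≤ A * c₀))
    simp only [mem_ofPred_eq, hg.zero] at this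
    exact this
  have h1C : 1 ≤ Real.exp (κ * c₀) * C₀ := by nlinarith
  refine ⟨Real.exp (κ * c₀) * C₀ + C₀ * g N / g m, ?_, ?_⟩
  · have : 0 ≤ C₀ * g N / g m := by positivity
    linarith
  intro j hj hjc x t ht
  have hr : (0:ℝ) < 2 ^ j := by positivity
  have ht' : |t| ≤ (2:ℝ) ^ (-j + 1) := by
    rw [zpow_add₀ (by norm_num), zpow_neg, zpow_one, inv_mul_eq_div, le_div_iff₀ hr]
    linarith
  have hpt : (2:ℝ) ^ (-5 - j) * (2 ^ 20 * A) = A * 2 ^ (15 - j) := by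
    have : (2:ℝ) ^ (15 - j) = (2:ℝ) ^ (-5 - j) * 2 ^ 20 := by
      rw [← zpow_natCast (2:ℝ) 20, ← zpow_add₀ (by norm_num)]; congr 1; push_cast; ring
    rw [this]; ring
  have hspec := (ha j).2
  rw [hpt] at hspec
  have hlow : (2:ℝ) ^ (-j + 1) ≤ 2 ^ (15 - j) := zpow_le_zpow_right₀ (by norm_num) (by linarith)
  have main : |γd x t| ≤ (Real.exp (κ * c₀) * C₀ + C₀ * g N / g m) * g (A * 2 ^ (15 - j)) := by
    have hgp : 0 < g (A * 2 ^ (15 - j)) := hg.pos _ (by positivity)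
    rcases le_or_gt ((2:ℝ) ^ (15 - j)) c₀ with hc | hc
    · have := gd_mono hA hC₀ hκ hg h x (ht'.trans hlow) hc
      have : 0 ≤ C₀ * g N / g m * g (A * 2 ^ (15 - j)) := by positivity
      linarith
    · have hle : (2:ℝ) ^ (15 - j) ≤ 2 ^ (14:ℕ) := by
        rw [← zpow_natCast (2:ℝ) 14]; exact zpow_le_zpow_right₀ (by norm_num) (by push_cast; linarith)
      have e1 : g m ≤ g (A * 2 ^ (15 - j)) := hmin ⟨by gcongr, by nlinarith⟩
      have e2 : g (A * |t|) ≤ g N := hmax ⟨by positivity, by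
        have := ht'.trans hjc
        gcongr⟩
      have e3 := (h.dbl x t (ht'.trans hjc)).2
      have e4 : C₀ * g N = C₀ * g N / g m * g m := by field_simp
      have e5 : C₀ * g N / g m * g m ≤ C₀ * g N / g m * g (A * 2 ^ (15 - j)) := by gcongr
      have e6 : 0 ≤ Real.exp (κ * c₀) * C₀ * g (A * 2 ^ (15 - j)) := by positivity
      have e7 : C₀ * g (A * |t|) ≤ C₀ * g N := by gcongr
      linarith
  set C := Real.exp (κ * c₀) * C₀ + C₀ * g N / g m
  have hC : 0 ≤ C := by positivity
  rw [zpow_neg, zpow_neg] at hspec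
  have hq : (0:ℝ) < 2 ^ a j := by positivity
  have : (2:ℝ) ^ a j * g (A * 2 ^ (15 - j)) ≤ 2 ^ j := by
    rw [inv_mul_eq_div, inv_eq_one_div, div_le_div_iff₀ hr hq] at hspec
    linarith
  calc _ ≤ (2:ℝ) ^ a j * (C * g (A * 2 ^ (15 - j))) := by gcongr
    _ = C * ((2:ℝ) ^ a j * g (A * 2 ^ (15 - j))) := by ring
    _ ≤ _ := by gcongr

lemma rq_bound {A : ℝ} {g : ℝ → ℝ} (hA : 1 ≤ A) (hg : IsDoubling g A) (a : ℤ → ℤ)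
    (ha : ajSpec g A a) : ∃ C : ℝ, 1 ≤ C ∧ ∀ j : ℤ, 1 ≤ j → (2:ℝ) ^ j ≤ C * (2:ℝ) ^ a j := by
  obtain ⟨N, hN, hmax⟩ := (isCompact_Icc (a := 0) (b := 2 ^ 14 * A)).exists_isMaxOn
    (nonempty_Icc.2 (by positivity)) (hg.cont.mono (fun u hu => hu.1))
  refine ⟨1 + 2 * |g N|, by linarith [abs_nonneg (g N)], fun j hj => ?_⟩
  have hr : (0:ℝ) < 2 ^ j := by positivity
  have hq : (0:ℝ) < 2 ^ a j := by positivity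
  have h1 := (ha j).1
  have hle : g ((2:ℝ) ^ (-5 - j) * (2 ^ 20 * A)) ≤ g N := hmax ⟨by positivity, by
    have : (2:ℝ) ^ (-5 - j) ≤ 2 ^ (-6:ℤ) := zpow_le_zpow_right₀ (by norm_num) (by linarith)
    have : (2:ℝ) ^ (-5 - j) * (2 ^ 20 * A) ≤ 2 ^ (-6:ℤ) * (2 ^ 20 * A) := by gcongr
    norm_num at this ⊢
    linarith⟩
  rw [zpow_sub₀ (by norm_num), zpow_neg, zpow_neg, zpow_one] at h1
  have h2 : (2 ^ a j : ℝ)⁻¹ / 2 < (2 ^ j : ℝ)⁻¹ * |g N| := h1.trans_le (by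
    gcongr; exact hle.trans (le_abs_self _))
  have h3 := mul_lt_mul_of_pos_right h2 (mul_pos hr hq)
  have e1 : (2 ^ a j : ℝ)⁻¹ / 2 * (2 ^ j * 2 ^ a j) = 2 ^ j / 2 := by field_simp
  have e2 : (2 ^ j : ℝ)⁻¹ * |g N| * (2 ^ j * 2 ^ a j) = |g N| * 2 ^ a j := by field_simp
  rw [e1, e2] at h3
  nlinarith

lemma subst_const (f : ℝ → ℂ) (hf : Continuous f) (hfi : Integrable f) (w w' : ℝ → ℝ)
    (hw : ∀ v, HasDerivAt w (w' v) v) (ht : Tendsto w atTop atTop) (hb : Tendsto w atBot atBot)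
    (hi : Integrable (fun v => (w' v : ℂ) * f (w v))) :
    ∫ v, (w' v : ℂ) * f (w v) = ∫ s, f s := by
  set F : ℝ → ℂ := fun s => ∫ u in (0:ℝ)..s, f u with hF
  have hd : ∀ s, HasDerivAt F (f s) s := fun s => (hf.integral_hasStrictDerivAt 0 s).hasDerivAt
  have h1 : Tendsto F atTop (nhds (∫ x in Ioi (0:ℝ), f x)) :=
    intervalIntegral_tendsto_integral_Ioi 0 hfi.integrableOn tendsto_id
  have h2 : Tendsto F atBot (nhds (-∫ x in Iic (0:ℝ), f x)) := by
    have := (intervalIntegral_tendsto_integral_Iic (f := f) 0 hfi.integrableOn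
      (tendsto_id (α := ℝ) (x := atBot))).neg
    refine this.congr fun s => ?_
    rw [hF]; simp only [id]; rw [← intervalIntegral.integral_symm]
  have e1 := integral_of_hasDerivAt_of_tendsto hd hfi h2 h1
  have hd2 : ∀ v, HasDerivAt (fun v => F (w v)) ((w' v : ℂ) * f (w v)) v := by
    intro v
    have := HasDerivAt.scomp v (hd (w v)) (hw v)
    rw [Complex.real_smul] at this
    exact this
  have e2 := integral_of_hasDerivAt_of_tendsto hd2 hi (h2.comp hb) (h1.comp ht)
  rw [e1, e2]

/-- auxiliary constant -/
def Ce (C : ℝ) : ℝ := C + C ^ 3 * Bc C * Iw ^ 2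

lemma canc_aux {C r q : ℝ} (hC : 1 ≤ C) (hr : 1 ≤ r) (hq : 0 < q)
    (φ : ℝ → ℝ) (hφc : Continuous φ) (hφb : ∀ s, |φ s| ≤ C)
    (hφs : ∀ s, φ s ≠ 0 → |s| < 2) (hφ0 : ∫ s, φ s = 0)
    (ψ : ℝ → ℂ) (hψc : Continuous ψ)
    (hψb : ∀ s, ‖ψ s‖ ≤ C * ((1 + |s|) ^ 5)⁻¹)
    (x : ℝ × ℝ) (θ : ℝ × ℝ → ℝ) (hθc : Continuous θ)
    (hθ : ∀ y : ℝ × ℝ, r * |x.1 - y.1| ≤ 2 → q * |x.2 - y.2| ≤ q * |θ y| + C)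
    (ω : ℝ × ℝ → ℝ) (hωc : Continuous ω) (σ : ℝ) (hσ : σ = 1 ∨ σ = -1)
    (hω : ∀ y : ℝ × ℝ, r * |x.1 - y.1| < 2 → |1 - ω y| ≤ C * r⁻¹)
    (hd : ∀ y₁ v, r * |x.1 - y₁| < 2 → HasDerivAt (fun v => σ * θ (y₁, v)) (ω (y₁, v)) v)
    (ht : ∀ y₁, r * |x.1 - y₁| < 2 → Tendsto (fun v => σ * θ (y₁, v)) atTop atTop)
    (hb : ∀ y₁, r * |x.1 - y₁| < 2 → Tendsto (fun v => σ * θ (y₁, v)) atBot atBot) :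
    ‖∫ y : ℝ × ℝ, ((r * φ (r * (x.1 - y.1)) : ℝ) : ℂ) * ((q : ℂ) * ψ (q * θ y))‖
      ≤ C ^ 3 * Bc C * Iw ^ 2 * r⁻¹ := by
  have hr0 : 0 < r := by linarith
  have hC0 : 0 < C := by linarith
  have hBc : 0 < Bc C := by unfold Bc; positivity
  have habs : ∀ s : ℝ, |r * s| = r * |s| := fun s => by rw [abs_mul, abs_of_pos hr0]
  have hφs2 : ∀ y₁, φ (r * (x.1 - y₁)) ≠ 0 → r * |x.1 - y₁| < 2 := by
    intro y₁ h; rw [← habs]; exact hφs _ h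
  have hwl : ∀ y : ℝ × ℝ, r * |x.1 - y.1| ≤ 2 →
      r * (q * ((1 + |q * θ y|) ^ 5)⁻¹) ≤ Bc C * Wt 2 r q (x - y) := fun y h =>
    (weight_loc hC hr0 hq h (hθ y h)).trans (by gcongr; exact Wt_mono (by norm_num) hr0 hq)
  set P : ℝ × ℝ → ℂ := fun y => ((r * φ (r * (x.1 - y.1)) : ℝ) : ℂ) * ((q : ℂ) * ψ (q * θ y))
    with hPdef
  have hPc : Continuous P := by rw [hPdef]; fun_prop
  have hP : ∀ y, ‖P y‖ ≤ C ^ 2 * Bc C * Wt 2 r q (x - y) := by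
    intro y
    have hw : 0 ≤ Wt 2 r q (x - y) := Wt_nonneg hr0 hq
    by_cases h : φ (r * (x.1 - y.1)) = 0
    · simp only [hPdef, h]; simp; positivity
    · have := hwl y (hφs2 _ h).le
      rw [hPdef]
      simp only []
      rw [norm_mul, norm_mul, Complex.norm_real, Complex.norm_real, Real.norm_of_nonneg hq.le,
        Real.norm_eq_abs, abs_mul, abs_of_pos hr0]
      calc _ ≤ r * C * (q * (C * ((1 + |q * θ y|) ^ 5)⁻¹)) := by
            gcongr
            · exact hφb _
            · exact hψb _
        _ = C ^ 2 * (r * (q * ((1 + |q * θ y|) ^ 5)⁻¹)) := by ring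
        _ ≤ C ^ 2 * (Bc C * Wt 2 r q (x - y)) := by gcongr
        _ = _ := by ring
  have hR : ∀ y, ‖P y * ((1 - ω y : ℝ) : ℂ)‖ ≤ (C ^ 3 * Bc C * r⁻¹) * Wt 2 r q (x - y) := by
    intro y
    have hw : 0 ≤ Wt 2 r q (x - y) := Wt_nonneg hr0 hq
    by_cases h : φ (r * (x.1 - y.1)) = 0
    · simp only [hPdef, h]; simp; positivity
    · rw [norm_mul, Complex.norm_real, Real.norm_eq_abs]
      calc _ ≤ (C ^ 2 * Bc C * Wt 2 r q (x - y)) * (C * r⁻¹) := by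
            gcongr
            · exact hP y
            · exact hω y (hφs2 _ h)
        _ = _ := by ring
  have hWi := Wt_integrable_sub hr0 hq x
  have hPi : Integrable P := (hWi.const_mul (C ^ 2 * Bc C)).mono' hPc.aestronglyMeasurable
    (Eventually.of_forall hP)
  have hRi : Integrable (fun y => P y * ((1 - ω y : ℝ) : ℂ)) :=
    (hWi.const_mul (C ^ 3 * Bc C * r⁻¹)).mono' (by
      apply Continuous.aestronglyMeasurable; fun_prop) (Eventually.of_forall hR)
  have hSi : Integrable (fun y => P y * ((ω y : ℝ) : ℂ)) := by
    refine (hPi.sub hRi).congr (Eventually.of_forall fun y => ?_)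
    simp only [Pi.sub_apply]; push_cast; ring
  have hsplit : ∫ y, P y = (∫ y, P y * ((ω y : ℝ) : ℂ)) + ∫ y, P y * ((1 - ω y : ℝ) : ℂ) := by
    rw [← integral_add hSi hRi]; congr 1; ext y; push_cast; ring
  have hσσ : σ * σ = 1 := by rcases hσ with h | h <;> rw [h] <;> norm_num
  have hψi : Integrable (fun s => ψ (σ * s)) := by
    refine ((wt_integrable (r := 1) one_pos).const_mul C).mono'
      (by apply Continuous.aestronglyMeasurable; fun_prop) (Eventually.of_forall fun s => ?_)
    refine (hψb _).trans ?_
    have : |σ * s| = |s| := by rcases hσ with h | h <;> rw [h] <;> simp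
    rw [this]
    have h5 := wt_mono (m := 2) (n := 5) (by norm_num) (r := 1) (s := s) one_pos
    have : wt 5 1 s = ((1 + |s|) ^ 5)⁻¹ := by unfold wt; simp
    rw [← this]; gcongr
  have hzero : ∫ y, P y * ((ω y : ℝ) : ℂ) = 0 := by
    have : (volume : Measure (ℝ × ℝ)) = (volume : Measure ℝ).prod volume := rfl
    rw [this, integral_prod _ (by rw [← this]; exact hSi)]
    have hin : ∀ y₁, ∫ v, P (y₁, v) * ((ω (y₁, v) : ℝ) : ℂ) =
        ((r * φ (r * (x.1 - y₁)) : ℝ) : ℂ) * ∫ s, ψ (σ * s) := by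
      intro y₁
      by_cases h : φ (r * (x.1 - y₁)) = 0
      · simp only [hPdef, h]; simp
      have h' := hφs2 _ h
      have hform : ∀ v, P (y₁, v) * ((ω (y₁, v) : ℝ) : ℂ) = ((r * φ (r * (x.1 - y₁)) : ℝ) : ℂ) *
          (((q * ω (y₁, v) : ℝ) : ℂ) * ψ (σ * (q * (σ * θ (y₁, v))))) := by
        intro v
        have : σ * (q * (σ * θ (y₁, v))) = q * θ (y₁, v) := by linear_combination q * θ (y₁, v) * hσσ
        rw [this]; simp only [hPdef]; push_cast; ring
      simp only [hform]
      rw [integral_const_mul]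
      congr 1
      have hbd : ∀ v, ‖((q * ω (y₁, v) : ℝ) : ℂ) * ψ (σ * (q * (σ * θ (y₁, v))))‖ ≤
          ((1 + C) * C * Bc C) * wt 2 q (x.2 - v) := by
        intro v
        have e : σ * (q * (σ * θ (y₁, v))) = q * θ (y₁, v) := by
          linear_combination q * θ (y₁, v) * hσσ
        have w1 := hwl (y₁, v) h'.le
        have w2 : Wt 2 r q (x - (y₁, v)) ≤ r * wt 2 q (x.2 - v) := by
          have h2 : wt 2 r (x.1 - y₁) ≤ r := by
            unfold wt
            apply mul_le_of_le_one_right hr0.le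
            apply inv_le_one_of_one_le₀
            apply one_le_pow₀
            have : 0 ≤ r * |x.1 - y₁| := by positivity
            linarith
          show wt 2 r (x.1 - y₁) * wt 2 q (x.2 - v) ≤ _
          have := wt_nonneg (n := 2) (s := x.2 - v) hq
          gcongr
        have w3 : r * (q * ((1 + |q * θ (y₁, v)|) ^ 5)⁻¹) ≤ r * (Bc C * wt 2 q (x.2 - v)) := by
          refine w1.trans ?_
          calc _ ≤ Bc C * (r * wt 2 q (x.2 - v)) := by gcongr
            _ = _ := by ring
        have w4 := le_of_mul_le_mul_left w3 hr0
        have w5 : |ω (y₁, v)| ≤ 1 + C := by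
          have := hω (y₁, v) h'
          have hri : r⁻¹ ≤ 1 := inv_le_one_of_one_le₀ hr
          have : |1 - ω (y₁, v)| ≤ C := this.trans (by nlinarith)
          have := abs_le.1 this
          rw [abs_le]; constructor <;> linarith
        rw [e, norm_mul, Complex.norm_real, Real.norm_eq_abs, abs_mul, abs_of_pos hq]
        calc _ ≤ q * (1 + C) * (C * ((1 + |q * θ (y₁, v)|) ^ 5)⁻¹) := by
              gcongr; exact hψb _
          _ = (1 + C) * C * (q * ((1 + |q * θ (y₁, v)|) ^ 5)⁻¹) := by ring
          _ ≤ (1 + C) * C * (Bc C * wt 2 q (x.2 - v)) := by gcongr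
          _ = _ := by ring
      exact subst_const (fun s => ψ (σ * s)) (by fun_prop) hψi (fun v => q * (σ * θ (y₁, v)))
        (fun v => q * ω (y₁, v)) (fun v => (hd y₁ v h').const_mul q)
        ((ht y₁ h').const_mul_atTop hq) ((hb y₁ h').const_mul_atBot hq)
        ((((wt_integrable hq).comp_sub_left x.2).const_mul _).mono'
          (by apply Continuous.aestronglyMeasurable; fun_prop) (Eventually.of_forall hbd))
    simp only [hin]
    rw [integral_mul_const]
    have : ∫ y₁, ((r * φ (r * (x.1 - y₁)) : ℝ) : ℂ) = 0 := by
      rw [integral_complex_ofReal, integral_const_mul,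
        integral_sub_left_eq_self (fun u => φ (r * u)) volume x.1,
        Measure.integral_comp_mul_left, hφ0]
      simp
    rw [this, zero_mul]
  rw [hsplit, hzero, zero_add]
  calc _ ≤ ∫ y, (C ^ 3 * Bc C * r⁻¹) * Wt 2 r q (x - y) :=
        norm_integral_le_of_norm_le (hWi.const_mul _) (Eventually.of_forall hR)
    _ = _ := by rw [integral_const_mul, Wt_integral_sub hr0 hq]; ring

lemma goodK_of2 {C r q : ℝ} (hC : 1 ≤ C) (hr : 1 ≤ r) (hq : 0 < q) (hrq : r ≤ C * q)
    (X : ℝ × ℝ → ℝ × ℝ → ℝ) (hXc : Continuous (Function.uncurry X))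
    (hXs : HasCompactSupport (Function.uncurry X)) (hXb : ∀ x y, |X x y| ≤ C)
    (hXd : ∀ x y, DifferentiableAt ℝ (X x) y ∧ ‖fderiv ℝ (X x) y‖ ≤ C)
    (φ φ' : ℝ → ℝ) (hφ : ∀ s, HasDerivAt φ (φ' s) s) (hφb : ∀ s, |φ s| ≤ C)
    (hφb' : ∀ s, |φ' s| ≤ C) (hφs : ∀ s, φ s ≠ 0 → |s| < 2) (hφs' : ∀ s, φ' s ≠ 0 → |s| ≤ 2)
    (hφ0 : ∫ s, φ s = 0)
    (ψ ψ' : ℝ → ℂ) (hψ : ∀ s, HasDerivAt ψ (ψ' s) s)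
    (hψb : ∀ s, ‖ψ s‖ ≤ C * ((1 + |s|) ^ 5)⁻¹)
    (hψb' : ∀ s, ‖ψ' s‖ ≤ C * ((1 + |s|) ^ 5)⁻¹)
    (θ : ℝ × ℝ → ℝ × ℝ → ℝ) (hθc : Continuous (Function.uncurry θ))
    (hθ : ∀ x y : ℝ × ℝ, r * |x.1 - y.1| ≤ 2 → q * |x.2 - y.2| ≤ q * |θ x y| + C)
    (hθ1 : ∀ x y : ℝ × ℝ, ∃ D, HasDerivAt (fun v => θ x (v, y.2)) D y.1 ∧
      (r * |x.1 - y.1| < 2 → q * |D| ≤ C * r))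
    (hθ2 : ∀ x y : ℝ × ℝ, ∃ D, HasDerivAt (fun v => θ x (y.1, v)) D y.2 ∧
      (r * |x.1 - y.1| < 2 → |D| ≤ C))
    (ω : ℝ × ℝ → ℝ × ℝ → ℝ) (hωc : ∀ x, Continuous (ω x)) (σ : ℝ) (hσ : σ = 1 ∨ σ = -1)
    (hω : ∀ x y : ℝ × ℝ, r * |x.1 - y.1| < 2 → |1 - ω x y| ≤ C * r⁻¹)
    (hd : ∀ (x : ℝ × ℝ) y₁ v, r * |x.1 - y₁| < 2 →
      HasDerivAt (fun v => σ * θ x (y₁, v)) (ω x (y₁, v)) v)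
    (ht : ∀ (x : ℝ × ℝ) y₁, r * |x.1 - y₁| < 2 →
      Tendsto (fun v => σ * θ x (y₁, v)) atTop atTop)
    (hb : ∀ (x : ℝ × ℝ) y₁, r * |x.1 - y₁| < 2 →
      Tendsto (fun v => σ * θ x (y₁, v)) atBot atBot)
    (K : ℝ × ℝ → ℝ × ℝ → ℂ)
    (hK : ∀ x y : ℝ × ℝ, K x y = ((X x y * (r * φ (r * (x.1 - y.1))) : ℝ) : ℂ) *
      ((q : ℂ) * ψ (q * θ x y))) :
    GoodK (Cc (Ce C)) r q K := by
  have hC0 : 0 < C := by linarith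
  have hr0 : 0 < r := by linarith
  have hBc : 0 < Bc C := by unfold Bc; positivity
  have hCe : C ≤ Ce C := by
    unfold Ce
    have : 0 ≤ C ^ 3 * Bc C * Iw ^ 2 := by positivity
    linarith
  have hφc : Continuous φ := continuous_iff_continuousAt.2 fun s => (hφ s).continuousAt
  have hψc : Continuous ψ := continuous_iff_continuousAt.2 fun s => (hψ s).continuousAt
  refine goodK_of (hC.trans hCe) hr hq (hrq.trans (by gcongr)) X hXc hXs
    (fun x y => (hXb x y).trans hCe) (fun x y => ⟨(hXd x y).1, (hXd x y).2.trans hCe⟩) φ φ' hφ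
    (fun s => (hφb s).trans hCe) (fun s => (hφb' s).trans hCe) hφs hφs' ψ ψ' hψ
    (fun s => (hψb s).trans (by gcongr)) (fun s => (hψb' s).trans (by gcongr)) θ hθc
    (fun x y h => (hθ x y h).trans (by gcongr)) ?_ ?_ K hK ?_
  · intro x y
    obtain ⟨D, h1, h2⟩ := hθ1 x y
    exact ⟨D, h1, fun h => (h2 h).trans (by gcongr)⟩
  · intro x y
    obtain ⟨D, h1, h2⟩ := hθ2 x y
    exact ⟨D, h1, fun h => (h2 h).trans hCe⟩
  · intro x
    refine (canc_aux hC hr hq φ hφc hφb hφs hφ0 ψ hψc hψb x (θ x)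
      (hθc.comp (by fun_prop : Continuous fun y : ℝ × ℝ => (x, y))) (hθ x) (ω x) (hωc x) σ hσ (hω x)
      (hd x) (ht x) (hb x)).trans ?_
    gcongr
    unfold Ce
    linarith

/-- the full derivative of the defining function -/
def Dg (γ : ℝ × ℝ → ℝ → ℝ) (x : ℝ × ℝ) (t : ℝ) : (ℝ × ℝ) × ℝ →L[ℝ] ℝ :=
  fderiv ℝ (fun p : (ℝ × ℝ) × ℝ => γ p.1 p.2) (x, t)

section curve
variable {c₀ A C₀ κ c₁ M : ℝ} {g : ℝ → ℝ} {γ γd γdd γ2 : ℝ × ℝ → ℝ → ℝ}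

lemma Dg_has (h : CurveHyp c₀ A C₀ κ c₁ M g γ γd γdd γ2) (x : ℝ × ℝ) (t : ℝ) :
    HasFDerivAt (fun p : (ℝ × ℝ) × ℝ => γ p.1 p.2) (Dg γ x t) (x, t) :=
  (h.smooth.differentiable (by simp) (x, t)).hasFDerivAt

lemma Dg_t (h : CurveHyp c₀ A C₀ κ c₁ M g γ γd γdd γ2) (x : ℝ × ℝ) (t : ℝ) :
    HasDerivAt (γ x) (Dg γ x t ((0, 0), 1)) t :=
  HasFDerivAt.comp_hasDerivAt (f := fun s : ℝ => (x, s)) t (Dg_has h x t)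
    ((hasDerivAt_const t x).prodMk (hasDerivAt_id t))

lemma Dg_2 (h : CurveHyp c₀ A C₀ κ c₁ M g γ γd γdd γ2) (a v : ℝ) (t : ℝ) :
    HasDerivAt (fun v => γ (a, v) t) (Dg γ (a, v) t ((0, 1), 0)) v :=
  HasFDerivAt.comp_hasDerivAt (f := fun v : ℝ => ((a, v), t)) v (Dg_has h (a, v) t)
    (((hasDerivAt_const v a).prodMk (hasDerivAt_id v)).prodMk (hasDerivAt_const v t))

lemma Dg_t_eq (h : CurveHyp c₀ A C₀ κ c₁ M g γ γd γdd γ2) (x : ℝ × ℝ) {t : ℝ} (ht : |t| ≤ c₀) :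
    Dg γ x t ((0, 0), 1) = γd x t := (Dg_t h x t).unique (h.deriv1 x t ht)

lemma Dg_2_eq (h : CurveHyp c₀ A C₀ κ c₁ M g γ γd γdd γ2) (x : ℝ × ℝ) {t : ℝ} (ht : |t| ≤ c₀) :
    Dg γ x t ((0, 1), 0) = γ2 x t := (Dg_2 h x.1 x.2 t).unique (h.derivx2 x t ht)

lemma Dg_cont (h : CurveHyp c₀ A C₀ κ c₁ M g γ γd γdd γ2) :
    Continuous (fun p : (ℝ × ℝ) × ℝ => Dg γ p.1 p.2) :=
  h.smooth.continuous_fderiv (by simp)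

lemma g2_near (h : CurveHyp c₀ A C₀ κ c₁ M g γ γd γdd γ2) (x : ℝ × ℝ) {t : ℝ} (ht : |t| < c₀) :
    |1 - Dg γ x t ((0, 1), 0)| ≤ M * |t| := by
  have hc := h.c₀_pos
  have hsm : ContDiff ℝ 1 (fun p : (ℝ × ℝ) × ℝ => Dg γ p.1 p.2 ((0, 1), 0)) :=
    (h.smooth.fderiv_right (m := 1) (by
      rw [one_add_one_eq_two]; exact WithTop.coe_le_coe.2 (le_top : (2:ℕ∞) ≤ ⊤))).clm_apply contDiff_const
  have hd : ∀ s, |s| < c₀ → HasFDerivAt (fun p : (ℝ × ℝ) × ℝ => γ2 p.1 p.2)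
      (fderiv ℝ (fun p : (ℝ × ℝ) × ℝ => γ2 p.1 p.2) (x, s)) (x, s) := by
    intro s hs
    have hev : (fun p : (ℝ × ℝ) × ℝ => γ2 p.1 p.2) =ᶠ[nhds (x, s)]
        (fun p : (ℝ × ℝ) × ℝ => Dg γ p.1 p.2 ((0, 1), 0)) := by
      have : ∀ᶠ p : (ℝ × ℝ) × ℝ in nhds (x, s), |p.2| < c₀ :=
        (continuous_snd.abs.isOpen_preimage (Iio c₀) isOpen_Iio).mem_nhds hs
      filter_upwards [this] with p hp
      exact (Dg_2_eq h p.1 hp.le).symm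
    exact ((hsm.differentiable (by simp) (x, s)).congr_of_eventuallyEq hev).hasFDerivAt
  have hd1 : ∀ s, |s| < c₀ → ∃ D, HasDerivAt (fun s => γ2 x s) D s ∧ ‖D‖ ≤ M := by
    intro s hs
    refine ⟨_, HasFDerivAt.comp_hasDerivAt (f := fun s : ℝ => (x, s)) s (hd s hs)
      ((hasDerivAt_const s x).prodMk (hasDerivAt_id s)), ?_⟩
    refine (ContinuousLinearMap.le_opNorm _ _).trans ?_
    have e : ‖((0 : ℝ × ℝ), (1 : ℝ))‖ = 1 := by simp [Prod.norm_def]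
    rw [e, mul_one]
    exact h.g2_grad x s hs.le
  have h0 : γ2 x 0 = 1 := by
    have e : (fun v => γ (x.1, v) 0) = fun v => v := by ext v; rw [h.init]
    have := h.derivx2 x 0 (by simpa using hc.le)
    rw [e] at this
    exact this.unique (hasDerivAt_id x.2)
  choose! f' hf' using hd1
  have hmem : ∀ s ∈ Set.uIcc 0 t, |s| < c₀ := fun s hs => by
    have := Set.abs_sub_left_of_mem_uIcc hs
    simp only [sub_zero] at this
    exact this.trans_lt ht
  have := (convex_uIcc 0 t).norm_image_sub_le_of_norm_hasDerivWithin_le (f := fun s => γ2 x s)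
    (f' := f') (C := M)
    (fun s hs => (hf' s (hmem s hs)).1.hasDerivWithinAt) (fun s hs => (hf' s (hmem s hs)).2)
    Set.left_mem_uIcc Set.right_mem_uIcc
  rw [h0, Real.norm_eq_abs, Real.norm_eq_abs, sub_zero] at this
  rw [Dg_2_eq h x ht.le, abs_sub_comm]
  exact this

lemma disp (h : CurveHyp c₀ A C₀ κ c₁ M g γ γd γdd γ2) {C r q : ℝ} (hr : 0 < r) (hq : 0 < q)
    (hC : 1 ≤ C) (hrc : 2 ≤ r * c₀)
    (hb : ∀ x t, r * |t| ≤ 2 → q * |γd x t| ≤ C * r) (x : ℝ × ℝ) {t : ℝ} (ht : r * |t| ≤ 2) :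
    q * |γ x t - x.2| ≤ 2 * C := by
  have hmem : ∀ s ∈ Set.uIcc 0 t, |s| ≤ |t| := fun s hs => by
    have := Set.abs_sub_left_of_mem_uIcc hs
    simpa only [sub_zero] using this
  have htc : |t| ≤ c₀ := le_of_mul_le_mul_left (ht.trans hrc) hr
  have := (convex_uIcc 0 t).norm_image_sub_le_of_norm_hasDerivWithin_le (f := γ x)
    (f' := γd x) (C := C * r / q)
    (fun s hs => (h.deriv1 x s ((hmem s hs).trans htc)).hasDerivWithinAt) (fun s hs => by
      rw [le_div_iff₀ hq, Real.norm_eq_abs, mul_comm]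
      have := hmem s hs
      exact hb x s (le_trans (by gcongr) ht))
    Set.left_mem_uIcc Set.right_mem_uIcc
  rw [h.init, Real.norm_eq_abs, Real.norm_eq_abs, sub_zero] at this
  calc _ ≤ q * (C * r / q * |t|) := by gcongr
    _ = C * (r * |t|) := by field_simp
    _ ≤ C * 2 := by gcongr
    _ = _ := mul_comm _ _

lemma dPhi (h : CurveHyp c₀ A C₀ κ c₁ M g γ γd γdd γ2)
    {γs γsd γsdd γs2 : ℝ × ℝ → ℝ → ℝ}
    (hs : CurveHyp c₀ A C₀ κ c₁ M g γs γsd γsdd γs2)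
    (hinv : ∀ (x : ℝ × ℝ) (t : ℝ), |t| ≤ c₀ → γs (x.1 - t, γ x t) t = x.2) (x₁ : ℝ) (y : ℝ × ℝ) :
    ∃ D, HasDerivAt (fun v => γ (v, y.2) (v - x₁)) D y.1 ∧
      (|y.1 - x₁| < c₀ → ∃ z, c₁ * |D| ≤ |γsd z (y.1 - x₁)|) := by
  have hD : HasDerivAt (fun v => γ (v, y.2) (v - x₁)) (Dg γ y (y.1 - x₁) ((1, 0), 1)) y.1 :=
    HasFDerivAt.comp_hasDerivAt (f := fun v : ℝ => ((v, y.2), v - x₁)) y.1 (Dg_has h y (y.1 - x₁))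
      (((hasDerivAt_id y.1).prodMk (hasDerivAt_const y.1 y.2)).prodMk
        ((hasDerivAt_id y.1).sub_const x₁))
  refine ⟨_, hD, fun ht => ?_⟩
  set D := Dg γ y (y.1 - x₁) ((1, 0), 1) with hDdef
  set z : ℝ × ℝ := (x₁, γ y (y.1 - x₁)) with hz
  refine ⟨z, ?_⟩
  have h1 : HasDerivAt (fun v => γs (x₁, γ (v, y.2) (v - x₁)) (v - x₁))
      (Dg γs z (y.1 - x₁) ((0, D), 1)) y.1 :=
    HasFDerivAt.comp_hasDerivAt (f := fun v : ℝ => ((x₁, γ (v, y.2) (v - x₁)), v - x₁)) y.1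
      (Dg_has hs z (y.1 - x₁))
      (((hasDerivAt_const y.1 x₁).prodMk hD).prodMk ((hasDerivAt_id y.1).sub_const x₁))
  have hev : (fun v => γs (x₁, γ (v, y.2) (v - x₁)) (v - x₁)) =ᶠ[nhds y.1] fun _ => y.2 := by
    have : ∀ᶠ v : ℝ in nhds y.1, |v - x₁| < c₀ :=
      ((by fun_prop : Continuous fun v : ℝ => |v - x₁|).isOpen_preimage (Iio c₀)
        isOpen_Iio).mem_nhds ht
    filter_upwards [this] with v hv
    have := hinv (v, y.2) (v - x₁) hv.le
    simpa using this
  have h0 := h1.unique ((hasDerivAt_const y.1 y.2).congr_of_eventuallyEq hev)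
  have hlin : (((0:ℝ), D), (1:ℝ)) = D • (((0:ℝ), (1:ℝ)), (0:ℝ)) + (((0:ℝ), (0:ℝ)), (1:ℝ)) := by
    simp
  rw [hlin, map_add, map_smul, Dg_2_eq hs z ht.le, Dg_t_eq hs z ht.le, smul_eq_mul] at h0
  have e : |γsd z (y.1 - x₁)| = |D| * |γs2 z (y.1 - x₁)| := by
    rw [← abs_mul, ← abs_neg (D * _)]; congr 1; linarith
  rw [e, mul_comm]
  have := hs.g2_lower z (y.1 - x₁) ht.le
  gcongr

end curve

lemma good_H (c₀ A C₀ κ c₁ M : ℝ) (hA : 1 ≤ A) (hC₀ : 1 ≤ C₀) (hκ : 0 ≤ κ) (hc₁ : 0 < c₁)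
    (g : ℝ → ℝ) (hg : IsDoubling g A)
    (γ γd γdd γ2 : ℝ × ℝ → ℝ → ℝ)
    (hγ : CurveHyp c₀ A C₀ κ c₁ M g γ γd γdd γ2)
    (γs γsd γsdd γs2 : ℝ × ℝ → ℝ → ℝ)
    (hγs : CurveHyp c₀ A C₀ κ c₁ M g γs γsd γsdd γs2)
    (hinv : ∀ (x : ℝ × ℝ) (t : ℝ), |t| ≤ c₀ → γs (x.1 - t, γ x t) t = x.2)
    (φ : ℝ → ℝ) (hφ : IsPhi φ)
    (hcanc : (∫ s : ℝ, φ s) = 0)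
    (χ : ℝ × ℝ → ℝ × ℝ → ℝ) (hχ : IsChi χ)
    (β0 : ℝ → ℝ) (hβ0 : IsBump β0)
    (a : ℤ → ℤ) (ha : ajSpec g A a) :
    ∃ C : ℝ, 0 ≤ C ∧ ∀ j : ℤ, 1 ≤ j → (2:ℝ) ^ (-j + 1) ≤ c₀ →
      GoodK C ((2:ℝ) ^ j) ((2:ℝ) ^ a j) (kernelH χ φ γ β0 j (a j)) ∧
      GoodK C ((2:ℝ) ^ j) ((2:ℝ) ^ a j) (adjK (kernelH χ φ γ β0 j (a j))) := by
  obtain ⟨ψ, ψ', c1, hψ, hψb, hψb', hψi⟩ := psi_exists β0 hβ0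
  obtain ⟨φ', c2, hφd, hφb, hφb', hφs, hφs'⟩ := phi_facts φ hφ
  obtain ⟨c3, hχb, hχ1, hχ2⟩ := chi_facts χ hχ
  obtain ⟨c4, hc4, hgd⟩ := gd_bound hA hC₀ hκ hg hγ a ha
  obtain ⟨c5, hc5, hgsd⟩ := gd_bound hA hC₀ hκ hg hγs a ha
  obtain ⟨c6, hc6, hrq⟩ := rq_bound hA hg a ha
  have hc5' : 0 < c5 / c₁ := by positivity
  have p1 := abs_nonneg c1
  have p2 := abs_nonneg c2
  have p3 := abs_nonneg c3
  have p4 := abs_nonneg M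
  have q1 := le_abs_self c1
  have q2 := le_abs_self c2
  have q3 := le_abs_self c3
  have q4 := le_abs_self M
  obtain ⟨C, hCdef⟩ : ∃ C, C = 1 + |c1| + |c2| + |c3| + 2 * c4 + c5 / c₁ + c6 + 2 * |M| := ⟨_, rfl⟩
  have hC : 1 ≤ C := by linarith
  have hC1 : c1 ≤ C := by linarith
  have hC2 : c2 ≤ C := by linarith
  have hC3 : c3 ≤ C := by linarith
  have hC4 : 2 * c4 ≤ C := by linarith
  have hC5 : c5 / c₁ ≤ C := by linarith
  have hC6 : c6 ≤ C := by linarith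
  have hC7 : 2 * |M| ≤ C := by linarith
  clear hCdef
  have hC0 : 0 < C := by linarith
  have hB : 0 < Bc C := by unfold Bc; positivity
  have hCe : 0 < Ce C := by unfold Ce; positivity
  have hBe : 0 < Bc (Ce C) := by unfold Bc; positivity
  refine ⟨Cc (Ce C), by unfold Cc; positivity, fun j hj hjc => ?_⟩
  have hgd := hgd j hj hjc
  have hgsd := hgsd j hj hjc
  have hrq := hrq j hj
  have hψi := hψi (a j)
  have hr1 : (1:ℝ) ≤ 2 ^ j := one_le_zpow₀ (by norm_num) (by linarith)
  have hq : (0:ℝ) < 2 ^ a j := by positivity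
  have hrc : 2 ≤ (2:ℝ) ^ j * c₀ := by
    have : (2:ℝ) ^ j * 2 ^ (-j + 1) = 2 := by
      rw [← zpow_add₀ (by norm_num)]; simp
    calc (2:ℝ) = (2:ℝ) ^ j * 2 ^ (-j + 1) := this.symm
      _ ≤ _ := by gcongr
  have hKer : ∀ x y : ℝ × ℝ, kernelH χ φ γ β0 j (a j) x y =
      ((χ x y * ((2:ℝ) ^ j * φ ((2:ℝ) ^ j * (x.1 - y.1))) : ℝ) : ℂ) *
        ((((2:ℝ) ^ a j : ℝ) : ℂ) * ψ ((2:ℝ) ^ a j * (y.2 - γ x (x.1 - y.1)))) := by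
    intro x y
    unfold kernelH phiJ
    rw [hψi]
  generalize kernelH χ φ γ β0 j (a j) = K at hKer ⊢
  generalize (2:ℝ) ^ j = r at *
  generalize (2:ℝ) ^ a j = q at *
  have hr0 : 0 < r := by linarith
  have hlt : ∀ t, r * |t| < 2 → |t| < c₀ := fun t ht =>
    lt_of_mul_lt_mul_left (ht.trans_le hrc) hr0.le
  have hdisp : ∀ (x : ℝ × ℝ) t, r * |t| ≤ 2 → q * |γ x t - x.2| ≤ C := fun x t ht =>
    (disp hγ hr0 hq hc4 hrc hgd x ht).trans hC4
  have hγc : Continuous (fun p : (ℝ × ℝ) × ℝ => γ p.1 p.2) := hγ.smooth.continuous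
  have hrqC : r ≤ C * q := hrq.trans (by gcongr)
  have hχc : Continuous (fun p : (ℝ × ℝ) × (ℝ × ℝ) => χ p.1 p.2) := hχ.smooth.continuous
  have hω0 : ∀ (x : ℝ × ℝ) t, r * |t| < 2 → |1 - Dg γ x t ((0, 1), 0)| ≤ C * r⁻¹ := by
    intro x t ht
    refine (g2_near hγ x (hlt t ht)).trans ?_
    have : |t| ≤ 2 * r⁻¹ := by
      rw [← div_eq_mul_inv, le_div_iff₀ hr0]; linarith
    calc M * |t| ≤ |M| * (2 * r⁻¹) := by gcongr
      _ = (2 * |M|) * r⁻¹ := by ring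
      _ ≤ C * r⁻¹ := by gcongr
  constructor
  · refine goodK_of2 hC hr1 hq hrqC χ hχc hχ.cpt (fun x y => (hχb x y).trans hC3)
      (fun x y => ⟨(hχ1 x y).1, (hχ1 x y).2.trans hC3⟩) φ φ' hφd (fun s => (hφb s).trans hC2)
      (fun s => (hφb' s).trans hC2) hφs hφs' hcanc ψ ψ' hψ
      (fun s => (hψb s).trans (by gcongr)) (fun s => (hψb' s).trans (by gcongr))
      (fun x y => y.2 - γ x (x.1 - y.1)) ?_ ?_ ?_ ?_ (fun _ _ => 1) (fun _ => continuous_const)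
      1 (Or.inl rfl) ?_ ?_ ?_ ?_ K hKer
    · have := hγc.comp (by fun_prop : Continuous fun p : (ℝ × ℝ) × (ℝ × ℝ) => (p.1, p.1.1 - p.2.1))
      exact (continuous_snd.comp continuous_snd).sub this
    · intro x y h
      have h1 := hdisp x _ h
      have h2 : |x.2 - y.2| ≤ |y.2 - γ x (x.1 - y.1)| + |γ x (x.1 - y.1) - x.2| := by
        rw [abs_sub_comm x.2]
        exact abs_sub_le _ _ _
      nlinarith
    · intro x y
      refine ⟨Dg γ x (x.1 - y.1) ((0, 0), 1), ?_, fun h => ?_⟩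
      · have h1 : HasDerivAt (fun v => x.1 - v) (-1) y.1 := (hasDerivAt_id y.1).const_sub x.1
        have := ((Dg_t hγ x (x.1 - y.1)).comp y.1 h1).const_sub y.2
        exact this.congr_deriv (by ring)
      · rw [Dg_t_eq hγ x (hlt _ h).le]
        refine (hgd x _ h.le).trans ?_
        gcongr
        linarith
    · intro x y
      exact ⟨1, (hasDerivAt_id y.2).sub_const (γ x (x.1 - y.1)), fun _ => by simpa using hC⟩
    · intro x y _
      simp; positivity
    · intro x y₁ v _
      simpa using (hasDerivAt_id v).sub_const (γ x (x.1 - y₁))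
    · intro x y₁ _
      simp only [one_mul]
      exact tendsto_atTop_add_const_right _ _ tendsto_id
    · intro x y₁ _
      simp only [one_mul]
      exact tendsto_atBot_add_const_right _ _ tendsto_id
  · have hcl : ∀ y₁ x₁ v : ℝ, r * |x₁ - y₁| < 2 → |γ (y₁, v) (y₁ - x₁) - v| ≤ C / q := by
      intro y₁ x₁ v h
      rw [abs_sub_comm] at h
      rw [le_div_iff₀ hq, mul_comm]
      exact hdisp (y₁, v) _ h.le
    refine goodK_of2 hC hr1 hq hrqC (fun x y => χ y x) (hχc.comp continuous_swap)
      (hχ.cpt.comp_homeomorph (Homeomorph.prodComm _ _)) (fun x y => (hχb y x).trans hC3)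
      (fun x y => ⟨(hχ2 y x).1, (hχ2 y x).2.trans hC3⟩) (fun s => φ (-s)) (fun s => -φ' (-s))
      (fun s => ((hφd (-s)).comp s (hasDerivAt_neg s)).congr_deriv (by ring))
      (fun s => (hφb (-s)).trans hC2)
      (fun s => by rw [abs_neg]; exact (hφb' (-s)).trans hC2)
      (fun s h => by have := hφs _ h; rwa [abs_neg] at this)
      (fun s h => by have := hφs' _ (neg_ne_zero.1 h); rwa [abs_neg] at this)
      (by rw [integral_neg_eq_self (fun s => φ s)]; exact hcanc)
      (fun s => star (ψ s)) (fun s => star (ψ' s)) (fun s => (hψ s).star)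
      (fun s => by rw [norm_star]; exact (hψb s).trans (by gcongr))
      (fun s => by rw [norm_star]; exact (hψb' s).trans (by gcongr))
      (fun x y => x.2 - γ y (y.1 - x.1)) ?_ ?_ ?_ ?_
      (fun x y => Dg γ y (y.1 - x.1) ((0, 1), 0)) ?_
      (-1) (Or.inr rfl) ?_ ?_ ?_ ?_ (adjK K) ?_
    · have := hγc.comp (by fun_prop : Continuous fun p : (ℝ × ℝ) × (ℝ × ℝ) => (p.2, p.2.1 - p.1.1))
      exact (continuous_snd.comp continuous_fst).sub this
    · intro x y h
      rw [abs_sub_comm x.1] at h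
      have h1 := hdisp y _ h
      have h2 : |x.2 - y.2| ≤ |x.2 - γ y (y.1 - x.1)| + |γ y (y.1 - x.1) - y.2| :=
        abs_sub_le _ _ _
      nlinarith
    · intro x y
      obtain ⟨D, hD, hDb⟩ := dPhi hγ hγs hinv x.1 y
      refine ⟨-D, hD.const_sub x.2, fun h => ?_⟩
      rw [abs_sub_comm] at h
      obtain ⟨z, hz⟩ := hDb (hlt _ h)
      have h1 := hgsd z _ h.le
      rw [abs_neg]
      have h2 : c₁ * (q * |D|) ≤ c5 * r := by
        calc c₁ * (q * |D|) = q * (c₁ * |D|) := by ring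
          _ ≤ q * |γsd z (y.1 - x.1)| := by gcongr
          _ ≤ _ := h1
      calc q * |D| ≤ c5 * r / c₁ := by rw [le_div_iff₀ hc₁]; linarith
        _ = c5 / c₁ * r := by ring
        _ ≤ C * r := by gcongr
    · intro x y
      refine ⟨-Dg γ y (y.1 - x.1) ((0, 1), 0), (Dg_2 hγ y.1 y.2 (y.1 - x.1)).const_sub x.2, fun h => ?_⟩
      rw [abs_sub_comm] at h
      rw [abs_neg, Dg_2_eq hγ y (hlt _ h).le]
      exact (hγ.g2_upper y _ (hlt _ h).le).trans (by linarith)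
    · intro x
      have := (Dg_cont hγ).comp (by fun_prop : Continuous fun y : ℝ × ℝ => (y, y.1 - x.1))
      exact this.clm_apply continuous_const
    · intro x y h
      rw [abs_sub_comm] at h
      exact hω0 y _ h
    · intro x y₁ v _
      exact (((Dg_2 hγ y₁ v (y₁ - x.1)).const_sub x.2).const_mul (-1)).congr_deriv (by ring)
    · intro x y₁ h
      refine tendsto_atTop_mono (f := fun v => v + (-(C / q) - x.2)) (fun v => ?_)
        (tendsto_atTop_add_const_right _ _ tendsto_id)
      have := abs_le.1 (hcl y₁ x.1 v h)
      show v + (-(C / q) - x.2) ≤ -1 * (x.2 - γ (y₁, v) (y₁ - x.1))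
      linarith [this.1]
    · intro x y₁ h
      refine tendsto_atBot_mono (f := fun v => v + (C / q - x.2)) (fun v => ?_)
        (tendsto_atBot_add_const_right _ _ tendsto_id)
      have := abs_le.1 (hcl y₁ x.1 v h)
      show -1 * (x.2 - γ (y₁, v) (y₁ - x.1)) ≤ v + (C / q - x.2)
      linarith [this.2]
    · intro x y
      unfold adjK
      rw [hKer, map_mul, map_mul, Complex.conj_ofReal, Complex.conj_ofReal]
      have : r * (y.1 - x.1) = -(r * (x.1 - y.1)) := by ring
      rw [this]
      rfl

/-- (2.9).  If `∫ φ = 0` then the operators `H_j` satisfy the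
almost-orthogonality estimates
`‖H_j H_k^*‖_{L²→L²} + ‖H_j^* H_k‖_{L²→L²} ≲ 2^{-|j-k|/2}`, uniformly in `j, k`. -/
theorem almost_orthogonality
    (c₀ A C₀ κ c₁ M : ℝ) (hA : 1 ≤ A) (hC₀ : 1 ≤ C₀) (hκ : 0 ≤ κ) (hc₁ : 0 < c₁)
    (g : ℝ → ℝ) (hg : IsDoubling g A)
    (γ γd γdd γ2 : ℝ × ℝ → ℝ → ℝ)
    (hγ : CurveHyp c₀ A C₀ κ c₁ M g γ γd γdd γ2)
    (γs γsd γsdd γs2 : ℝ × ℝ → ℝ → ℝ)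
    (hγs : CurveHyp c₀ A C₀ κ c₁ M g γs γsd γsdd γs2)
    (hinv : ∀ (x : ℝ × ℝ) (t : ℝ), |t| ≤ c₀ → γs (x.1 - t, γ x t) t = x.2)
    (𝔞 : ℝ × ℝ → ℝ × ℝ → ℝ)
    (h𝔞 : ∀ x y : ℝ × ℝ, 𝔞 x y = ∫ s in Icc (0:ℝ) 1,
      γ2 (x.1, (1 - s) * γs y (y.1 - x.1) + s * x.2) (x.1 - y.1))
    (φ : ℝ → ℝ) (hφ : IsPhi φ)
    (hcanc : (∫ s : ℝ, φ s) = 0)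
    (χ : ℝ × ℝ → ℝ × ℝ → ℝ) (hχ : IsChi χ)
    (h𝔞near : ∀ x y : ℝ × ℝ, χ x y ≠ 0 → |𝔞 x y - 1| ≤ 1 / 2)
    (β0 : ℝ → ℝ) (hβ0 : IsBump β0)
    (a : ℤ → ℤ) (ha : ajSpec g A a) :
    ∃ C : ℝ, 0 < C ∧ ∀ j k : ℤ,
      1 ≤ j → 1 ≤ k → (2:ℝ) ^ (-j + 1) ≤ c₀ → (2:ℝ) ^ (-k + 1) ≤ c₀ →
      opNorm 2 (fun f => opK (kernelH χ φ γ β0 j (a j))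
          (opK (adjK (kernelH χ φ γ β0 k (a k))) f))
        + opNorm 2 (fun f => opK (adjK (kernelH χ φ γ β0 j (a j)))
          (opK (kernelH χ φ γ β0 k (a k)) f))
        ≤ ENNReal.ofReal (C * (2:ℝ) ^ (-(|(j:ℝ) - (k:ℝ)|) / 2)) := by
  obtain ⟨C, hC, hgood⟩ := good_H c₀ A C₀ κ c₁ M hA hC₀ hκ hc₁ g hg γ γd γdd γ2 hγ γs γsd γsdd γs2
    hγs hinv φ hφ hcanc χ hχ β0 hβ0 a ha
  have hinvol : ∀ K : ℝ × ℝ → ℝ × ℝ → ℂ, adjK (adjK K) = K := by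
    intro K; funext x y; simp [adjK]
  have hI := Iw_nonneg
  obtain ⟨N, hN, hN1, hN2⟩ : ∃ N : ℝ, 0 ≤ N ∧ (C * Iw ^ 2) ^ 2 ≤ N ∧
      C ^ 2 * (Iw ^ 2 + 1) * Iw ^ 2 ≤ N :=
    ⟨(C * Iw ^ 2) ^ 2 + C ^ 2 * (Iw ^ 2 + 1) * Iw ^ 2, by positivity,
      le_add_of_nonneg_right (by positivity), le_add_of_nonneg_left (by positivity)⟩
  have hA0 : 0 < A := by linarith
  -- the exponent as a real power
  have hpow : ∀ d : ℤ, 0 ≤ d → (2:ℝ) ^ (-d) ≤ (2:ℝ) ^ (-(|(d:ℝ)|) / 2) := by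
    intro d hd
    rw [← Real.rpow_intCast]
    apply Real.rpow_le_rpow_of_exponent_le (by norm_num)
    have : (0:ℝ) ≤ d := by exact_mod_cast hd
    rw [abs_of_nonneg this]; push_cast; linarith
  -- the main bound, for `j ≤ k`
  have main : ∀ j k : ℤ, 1 ≤ j → j ≤ k → ∀ K L : ℝ × ℝ → ℝ × ℝ → ℂ,
      GoodK C ((2:ℝ) ^ j) ((2:ℝ) ^ a j) K → GoodK C ((2:ℝ) ^ k) ((2:ℝ) ^ a k) L →
      opNorm 2 (fun f => opK K (opK (adjK L) f)) ≤
        ENNReal.ofReal (N * A * (2:ℝ) ^ (-(|(j:ℝ) - (k:ℝ)|) / 2)) ∧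
      opNorm 2 (fun f => opK L (opK (adjK K) f)) ≤
        ENNReal.ofReal (N * A * (2:ℝ) ^ (-(|(j:ℝ) - (k:ℝ)|) / 2)) := by
    intro j k hj hjk K L hK hL
    have hd := hpow (k - j) (by linarith)
    have habs : |((k - j : ℤ) : ℝ)| = |(j:ℝ) - (k:ℝ)| := by push_cast; rw [abs_sub_comm]
    rw [habs] at hd
    have hr : (0:ℝ) < 2 ^ j := by positivity
    have hq : (0:ℝ) < 2 ^ a j := by positivity
    have hr' : (0:ℝ) < 2 ^ k := by positivity
    have hq' : (0:ℝ) < 2 ^ a k := by positivity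
    have hρ : (0:ℝ) < 2 ^ (-(k - j)) := by positivity
    have hρr : (2:ℝ) ^ (-(k - j)) * 2 ^ k = 2 ^ j := by
      rw [← zpow_add₀ (by norm_num)]; congr 1; ring
    rcases le_or_gt A ((2:ℝ) ^ (k - j)) with hAk | hAk
    · have h2 : (2:ℝ) ^ a j ≤ 2 ^ (-(k - j)) * 2 ^ a k := by
        have hd2 := hg.dbl ((2:ℝ) ^ (-5 - k) * (2 ^ 20 * A)) ((2:ℝ) ^ (-5 - j) * (2 ^ 20 * A))
          (by positivity) (by
            have : (2:ℝ) ^ (-5 - j) = 2 ^ (k - j) * 2 ^ (-5 - k) := by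
              rw [← zpow_add₀ (by norm_num)]; congr 1; ring
            rw [this]
            have hp : 0 ≤ (2:ℝ) ^ (-5 - k) * (2 ^ 20 * A) := by positivity
            have := mul_le_mul_of_nonneg_right hAk hp
            linarith)
        have s1 := (ha k).1
        have s2 := (ha j).2
        set Gj := g ((2:ℝ) ^ (-5 - j) * (2 ^ 20 * A))
        set Gk := g ((2:ℝ) ^ (-5 - k) * (2 ^ 20 * A))
        rw [zpow_sub₀ (by norm_num), zpow_neg, zpow_neg, zpow_one] at s1
        rw [zpow_neg, zpow_neg] at s2
        have t1 : (2 ^ k : ℝ) < 2 * Gk * 2 ^ a k := by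
          have := mul_lt_mul_of_pos_right s1 (mul_pos hr' hq')
          have e1 : (2 ^ a k : ℝ)⁻¹ / 2 * (2 ^ k * 2 ^ a k) = 2 ^ k / 2 := by field_simp
          have e2 : (2 ^ k : ℝ)⁻¹ * Gk * (2 ^ k * 2 ^ a k) = Gk * 2 ^ a k := by field_simp
          rw [e1, e2] at this
          linarith
        have t2 : Gj * 2 ^ a j ≤ 2 ^ j := by
          have := mul_le_mul_of_nonneg_right s2 (mul_pos hr hq).le
          have e1 : (2 ^ a j : ℝ)⁻¹ * (2 ^ j * 2 ^ a j) = 2 ^ j := by field_simp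
          have e2 : (2 ^ j : ℝ)⁻¹ * Gj * (2 ^ j * 2 ^ a j) = Gj * 2 ^ a j := by field_simp
          rw [e1, e2] at this
          linarith
        have hGj : 0 < Gj := hg.pos _ (by positivity)
        have t3 : Gj * 2 ^ a j ≤ Gj * (2 ^ (-(k - j)) * 2 ^ a k) := by
          calc _ ≤ (2:ℝ) ^ j := t2
            _ = 2 ^ (-(k - j)) * 2 ^ k := hρr.symm
            _ ≤ 2 ^ (-(k - j)) * (2 * Gk * 2 ^ a k) := by gcongr
            _ ≤ 2 ^ (-(k - j)) * (Gj * 2 ^ a k) := by gcongr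
            _ = _ := by ring
        exact le_of_mul_le_mul_left t3 hGj
      have hfin := opNorm_fine hK hL hC hr hq hr' hq' hρ
        (zpow_le_one_of_nonpos₀ (by norm_num) (by linarith)) hρr.ge h2
        (by rw [← zpow_neg]; exact zpow_le_zpow_right₀ (by norm_num) (by linarith))
      have hle : C ^ 2 * (Iw ^ 2 + 1) * 2 ^ (-(k - j)) * Iw ^ 2 ≤
          N * A * (2:ℝ) ^ (-(|(j:ℝ) - (k:ℝ)|) / 2) := by
        calc _ = C ^ 2 * (Iw ^ 2 + 1) * Iw ^ 2 * 2 ^ (-(k - j)) := by ring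
          _ ≤ N * (2:ℝ) ^ (-(|(j:ℝ) - (k:ℝ)|) / 2) := by gcongr
          _ ≤ N * A * (2:ℝ) ^ (-(|(j:ℝ) - (k:ℝ)|) / 2) := by
            gcongr; exact le_mul_of_one_le_right hN hA
      exact ⟨hfin.1.trans (ENNReal.ofReal_le_ofReal hle),
        hfin.2.trans (ENNReal.ofReal_le_ofReal hle)⟩
    · have hle : (C * Iw ^ 2) ^ 2 ≤ N * A * (2:ℝ) ^ (-(|(j:ℝ) - (k:ℝ)|) / 2) := by
        have h1 : 1 ≤ A * (2:ℝ) ^ (-(|(j:ℝ) - (k:ℝ)|) / 2) := by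
          calc (1:ℝ) = 2 ^ (k - j) * 2 ^ (-(k - j)) := by
                rw [← zpow_add₀ (by norm_num)]; simp
            _ ≤ _ := by gcongr
        calc _ ≤ N * 1 := by linarith
          _ ≤ N * (A * (2:ℝ) ^ (-(|(j:ℝ) - (k:ℝ)|) / 2)) := by gcongr
          _ = _ := by ring
      exact ⟨(opNorm_crude hK hL hC hr hq hr' hq').trans (ENNReal.ofReal_le_ofReal hle),
        (opNorm_crude hL hK hC hr' hq' hr hq).trans (ENNReal.ofReal_le_ofReal hle)⟩
  refine ⟨2 * (N * A) + 1, by positivity, fun j k hj hk hjc hkc => ?_⟩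
  obtain ⟨gj, gj'⟩ := hgood j hj hjc
  obtain ⟨gk, gk'⟩ := hgood k hk hkc
  set Hj := kernelH χ φ γ β0 j (a j)
  set Hk := kernelH χ φ γ β0 k (a k)
  have hP : 0 ≤ (2:ℝ) ^ (-(|(j:ℝ) - (k:ℝ)|) / 2) := by positivity
  have both : opNorm 2 (fun f => opK Hj (opK (adjK Hk) f)) ≤
        ENNReal.ofReal (N * A * (2:ℝ) ^ (-(|(j:ℝ) - (k:ℝ)|) / 2)) ∧
      opNorm 2 (fun f => opK (adjK Hj) (opK Hk f)) ≤
        ENNReal.ofReal (N * A * (2:ℝ) ^ (-(|(j:ℝ) - (k:ℝ)|) / 2)) := by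
    rcases le_total j k with h | h
    · have m1 := (main j k hj h Hj Hk gj gk).1
      have m2 := (main j k hj h (adjK Hj) (adjK Hk) gj' gk').1
      rw [hinvol] at m2
      exact ⟨m1, m2⟩
    · have m1 := (main k j hk h Hk Hj gk gj).2
      have m2 := (main k j hk h (adjK Hk) (adjK Hj) gk' gj').2
      rw [hinvol] at m2
      rw [abs_sub_comm] at m1 m2
      exact ⟨m1, m2⟩
  refine (add_le_add both.1 both.2).trans ?_
  rw [← ENNReal.ofReal_add (by positivity) (by positivity)]
  apply ENNReal.ofReal_le_ofReal
  linarith
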